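/- arXiv:math/0208172 — 3 statements merged into one kernel-verified Lean document; each statement's English description precedes it below -/
import Mathlib

section
/- Let Q be a generically Gorenstein Cohen-Macaulay local ring that is a homomorphic image of a Gorenstein local ring, let g be a Q-regular sequence of length s ≥ 1, and set R = Q/(g). Then R ≅ P/(g') where P is a generically Gorenstein Cohen-Macaulay local ring that is a homomorphic image of a Gorenstein local ring and g' is a single P-regular element. -/
open CategoryTheory CategoryTheory.Limits CochainComplex.HomComplex

noncomputable section

/-- The category of cochain complexes of `R`-modules indexed by `ℤ`.  We identify a chain
complex with homology `H_i` with the cochain complex whose cohomology in degree `n` is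
`H_{-n}`. -/
abbrev Cx (R : Type) [CommRing R] := CochainComplex (ModuleCat R) ℤ

/-- The complex consisting of the module `M` concentrated in degree `0`. -/
abbrev sgl {R : Type} [CommRing R] (M : ModuleCat R) : Cx R :=
  (HomologicalComplex.single (ModuleCat R) (ComplexShape.up ℤ) 0).obj M

/-- `π : F ⟶ M` is a semiprojective resolution of `M`:  `F` is a bounded above
complex of projective modules and `π` is a quasi-isomorphism. -/
def IsSemiprojResolution {R : Type} [CommRing R] {F M : Cx R} (π : F ⟶ M) : Prop :=
  (∀ n : ℤ, Projective (F.X n)) ∧ (∃ b : ℤ, ∀ n : ℤ, b ≤ n → IsZero (F.X n)) ∧ QuasiIso π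

/-- Vanishing of the hyper-Ext group `Ext^i(M, N)`:  computed from any semiprojective
resolution `F` of `M`, every `i`-cocycle of the Hom-complex `Hom(F, N)` is a coboundary. -/
def ExtVanishes {R : Type} [CommRing R] (M N : Cx R) (i : ℤ) : Prop :=
  ∀ (F : Cx R) (π : F ⟶ M), IsSemiprojResolution π →
    ∀ f : Cochain F N i, δ i (i+1) f = 0 → ∃ g : Cochain F N (i-1), δ (i-1) i g = f

/-- The `i`-th hyper-Ext module computed from a resolution `F` of the first variable:
the cocycles modulo the coboundaries in the Hom-complex `Hom(F, N)`. -/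
abbrev extModule (R : Type) [CommRing R] (F N : Cx R) (i : ℤ) :=
  ↥(LinearMap.ker (δ_hom R F N i (i+1))) ⧸
    (Submodule.comap (LinearMap.ker (δ_hom R F N i (i+1))).subtype
      (LinearMap.range (δ_hom R F N (i-1) i)))

/-- `Ext^i(M, N) ≅ k`, the residue field of the local ring `R`. -/
def ExtIsResidueField (R : Type) [CommRing R] [IsLocalRing R] (M N : Cx R) (i : ℤ) : Prop :=
  ∀ (F : Cx R) (π : F ⟶ M), IsSemiprojResolution π →
    Nonempty ((extModule R F N i) ≃ₗ[R] (R ⧸ IsLocalRing.maximalIdeal R))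

/-- `D` is a dualizing complex for the local ring `R`, normalized so that
`H_i(D) = 0` for `i < 0` and `H_0(D) ≠ 0` (recall `H_i(D) = H^{-i}(D)`):  it has bounded,
degreewise finitely generated homology and `Ext^i(k, D)` is `k` for exactly one `i` and
zero otherwise. -/
structure IsNormalizedDualizingComplex (R : Type) [CommRing R] [IsLocalRing R] (D : Cx R) :
    Prop where
  finite_homology : ∀ n : ℤ, Module.Finite R (D.homology n)
  homology_bounded : ∃ a : ℤ, ∀ n : ℤ, n < a → IsZero (D.homology n)
  vanish_neg : ∀ n : ℤ, 0 < n → IsZero (D.homology n)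
  nonzero_zero : ¬ IsZero (D.homology 0)
  ext_residue : ∃ d : ℤ,
    ExtIsResidueField R (sgl (ModuleCat.of R (R ⧸ IsLocalRing.maximalIdeal R))) D d ∧
    ∀ i : ℤ, i ≠ d →
      ExtVanishes (sgl (ModuleCat.of R (R ⧸ IsLocalRing.maximalIdeal R))) D i

/-- The depth of a local ring: the smallest `i` with `Ext^i(k, R) ≠ 0`. -/
def ringDepth (R : Type) [CommRing R] [IsLocalRing R] : ℕ∞ :=
  sInf { n : ℕ∞ | ∃ i : ℕ, n = i ∧
    ¬ IsZero (((Ext R (ModuleCat R) i).obj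
        (Opposite.op (ModuleCat.of R (R ⧸ IsLocalRing.maximalIdeal R)))).obj
        (ModuleCat.of R R)) }

/-- A local ring is Cohen-Macaulay if its depth equals its Krull dimension. -/
def IsCohenMacaulayLocalRing (R : Type) [CommRing R] [IsLocalRing R] : Prop :=
  (ringDepth R : WithBot ℕ∞) = ringKrullDim R

/-- `R` has finite injective dimension as a module over itself. -/
def HasFiniteSelfInjDim (R : Type) [CommRing R] : Prop :=
  ∃ n : ℕ, ∀ (M : ModuleCat R) (i : ℕ), n < i →
    IsZero (((Ext R (ModuleCat R) i).obj (Opposite.op M)).obj (ModuleCat.of R R))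

/-- A Gorenstein local ring: a noetherian local ring of finite self-injective dimension. -/
def IsGorensteinLocalRing (R : Type) [CommRing R] : Prop :=
  IsNoetherianRing R ∧ IsLocalRing R ∧ HasFiniteSelfInjDim R

/-- A commutative ring is generically Gorenstein if its localization at every
associated prime is a Gorenstein (local) ring. -/
def IsGenericallyGorenstein (R : Type) [CommRing R] : Prop :=
  ∀ (p : Ideal R) (hp : p.IsPrime), p ∈ associatedPrimes R R →
    IsGorensteinLocalRing (@Localization.AtPrime R _ p hp)

/-- The derived-functor `Ext` module vanishes iff the derived-category `Ext` group does. -/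
lemma isZero_Ext_iff_subsingleton {R : Type} [CommRing R] (X Y : ModuleCat.{0} R) (n : ℕ) :
    IsZero (((Ext R (ModuleCat R) n).obj (Opposite.op X)).obj Y) ↔
      Subsingleton (Abelian.Ext.{0} X Y n) := by
  obtain ⟨P⟩ := (inferInstance : HasProjectiveResolution X).out
  rw [(P.isoExt n Y).isZero_iff, ← HomologicalComplex.exactAt_iff_isZero_homology]
  cases n with
  | zero =>
    rw [HomologicalComplex.exactAt_iff' _ 0 0 1 (by simp) (by simp),
      ShortComplex.moduleCat_exact_iff, Abelian.Ext.homEquiv₀.subsingleton_congr]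
    change _ ↔ Subsingleton (((ChainComplex.single₀ (ModuleCat R)).obj X).X 0 ⟶ Y)
    have hd : P.complex.d 0 0 = 0 := HomologicalComplex.shape _ _ _ (by simp)
    constructor
    · intro h
      refine subsingleton_of_forall_eq 0 fun e => ?_
      have hz : P.complex.d 1 0 ≫ P.π.f 0 ≫ e = 0 := by
        rw [← Category.assoc, P.complex_d_comp_π_f_zero, zero_comp]
      obtain ⟨g, hg⟩ : ∃ g : P.complex.X 0 ⟶ Y, P.complex.d 0 0 ≫ g = P.π.f 0 ≫ e :=
        h (P.π.f 0 ≫ e) hz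
      rw [hd, zero_comp] at hg
      rw [← cancel_epi (P.π.f 0), ← hg, comp_zero]
    · intro h f hf
      have key (f : P.complex.X 0 ⟶ Y) (hf : P.complex.d 1 0 ≫ f = 0) :
          ∃ g : P.complex.X 0 ⟶ Y, P.complex.d 0 0 ≫ g = f := by
        refine ⟨0, ?_⟩
        have : P.π.f 0 ≫ P.exact₀.desc f hf = f := P.exact₀.g_desc f hf
        rw [comp_zero, ← this, Subsingleton.elim (P.exact₀.desc f hf) 0, comp_zero]
      exact key f hf
  | succ n =>
    rw [HomologicalComplex.exactAt_iff' _ n (n + 1) (n + 2) (by simp) (by simp),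
      ShortComplex.moduleCat_exact_iff]
    constructor
    · intro h
      refine subsingleton_of_forall_eq 0 fun e => ?_
      obtain ⟨f, hf, rfl⟩ := P.extMk_surjective e (n + 2) rfl
      rw [P.extMk_eq_zero_iff _ _ _ _ n rfl]
      exact h f hf
    · intro h f hf
      exact (P.extMk_eq_zero_iff f (n + 2) rfl hf n rfl).1 (Subsingleton.elim _ _)

/-- A ring has finite self-injective dimension iff it does so in the sense of Mathlib. -/
lemma hasFiniteSelfInjDim_iff {R : Type} [CommRing R] :
    HasFiniteSelfInjDim R ↔ ∃ n : ℕ, HasInjectiveDimensionLE (ModuleCat.of R R) n := by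
  simp only [HasFiniteSelfInjDim, isZero_Ext_iff_subsingleton]
  refine exists_congr fun n => ⟨fun h => ?_, fun h M i hi => ?_⟩
  · exact HasInjectiveDimensionLT.mk fun i hi Y e => (h Y i hi).elim _ _
  · exact HasInjectiveDimensionLT.subsingleton _ (n + 1) i hi M

/-- The module `N` over `A` has injective dimension at most `n`. -/
abbrev InjDimLE (A N : Type) [CommRing A] [AddCommGroup N] [Module A N] (n : ℕ) : Prop :=
  HasInjectiveDimensionLE (ModuleCat.of A N) n

lemma injDimLE_zero_iff {A N : Type} [CommRing A] [AddCommGroup N] [Module A N] :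
    InjDimLE A N 0 ↔ Module.Injective A N := by
  rw [Module.injective_iff_injective_object]
  exact injective_iff_hasInjectiveDimensionLT_one.symm

lemma InjDimLE.mono {A N : Type} [CommRing A] [AddCommGroup N] [Module A N] {m n : ℕ}
    (h : InjDimLE A N m) (hmn : m ≤ n) : InjDimLE A N n :=
  hasInjectiveDimensionLT_of_ge _ (m + 1) _ (by omega)

section
attribute [local instance] RingHomInvPair.of_ringEquiv

lemma InjDimLE.of_ringEquiv {A B : Type} [CommRing A] [CommRing B] (e : A ≃+* B) {n : ℕ}
    (h : InjDimLE A A n) : InjDimLE B B n := by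
  let e' : (ModuleCat.of A A) ≃ₛₗ[RingHomClass.toRingHom e] (ModuleCat.of B B) :=
    { e.toAddEquiv with map_smul' := fun r x => e.map_mul r x }
  exact (ModuleCat.hasInjectiveDimensionLE_iff_of_semiLinearEquiv e e' n).1 h
end

lemma InjDimLE.localization {A : Type} [CommRing A] [IsNoetherianRing A] (q : Ideal A)
    [q.IsPrime] {n : ℕ} (h : InjDimLE A A n) :
    InjDimLE (Localization.AtPrime q) (Localization.AtPrime q) n := by
  have h1 := (ModuleCat.of A A).localizedModule_hasInjectiveDimensionLE n q.primeCompl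
  have h2 := (ModuleCat.of A A).localizedModule_isLocalizedModule q.primeCompl
  let l : (ModuleCat.of A A) →ₗ[A] Localization.AtPrime q := Algebra.linearMap A _
  have h3 : IsLocalizedModule q.primeCompl l :=
    inferInstanceAs (IsLocalizedModule q.primeCompl (Algebra.linearMap A (Localization.AtPrime q)))
  refine (ModuleCat.hasInjectiveDimensionLE_iff_of_linearEquiv ?_ n).1 h1
  exact LinearEquiv.extendScalarsOfIsLocalization q.primeCompl (Localization.AtPrime q)
    (IsLocalizedModule.linearEquiv q.primeCompl
      ((ModuleCat.of A A).localizedModuleMkLinearMap q.primeCompl)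
      l)

section Exact

variable {A X Y Z : Type} [CommRing A] [AddCommGroup X] [Module A X] [AddCommGroup Y] [Module A Y]
  [AddCommGroup Z] [Module A Z] {f : X →ₗ[A] Y} {g : Y →ₗ[A] Z}

/-- The short exact sequence in `ModuleCat A` attached to linear maps. -/
lemma shortExact_of_linearMap (hf : Function.Injective f) (hfg : Function.Exact f g)
    (hg : Function.Surjective g) :
    (ModuleCat.shortComplexOfCompEqZero f g hfg.linearMap_comp_eq_zero).ShortExact :=
  ModuleCat.shortComplex_shortExact _ hfg hf hg

lemma injDimLE_succ_iff (hf : Function.Injective f) (hfg : Function.Exact f g)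
    (hg : Function.Surjective g) [hY : Module.Injective A Y] (n : ℕ) :
    InjDimLE A X (n + 1) ↔ InjDimLE A Z n :=
  ((shortExact_of_linearMap hf hfg hg).hasInjectiveDimensionLT_X₃_iff n
    ((Module.injective_iff_injective_object A Y).1 hY)).symm

end Exact

lemma exists_injective_embedding (A N : Type) [CommRing A] [AddCommGroup N] [Module A N] :
    ∃ (I : Type) (_ : AddCommGroup I) (_ : Module A I) (_ : Module.Injective A I)
      (f : N →ₗ[A] I), Function.Injective f := by
  obtain ⟨⟨I, hI, f, hf⟩⟩ := EnoughInjectives.presentation (ModuleCat.of A N)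
  exact ⟨I, inferInstance, inferInstance, Module.injective_module_of_injective_object A I, f.hom,
    (ModuleCat.mono_iff_injective f).1 hf⟩

/-- The vanishing of `Ext^i_A(L, N)`. -/
abbrev ExtVanish (A L N : Type) [CommRing A] [AddCommGroup L] [Module A L] [AddCommGroup N]
    [Module A N] (i : ℕ) : Prop :=
  Subsingleton (Abelian.Ext.{0} (ModuleCat.of A L) (ModuleCat.of A N) i)

section ExtVanish

variable {A L X Y Z : Type} [CommRing A] [AddCommGroup L] [Module A L]
  [AddCommGroup X] [Module A X] [AddCommGroup Y] [Module A Y]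
  [AddCommGroup Z] [Module A Z] {f : X →ₗ[A] Y} {g : Y →ₗ[A] Z}

lemma extVanish_zero_iff : ExtVanish A L X 0 ↔ ∀ φ : L →ₗ[A] X, φ = 0 := by
  rw [ExtVanish, Abelian.Ext.homEquiv₀.subsingleton_congr,
    ModuleCat.homEquiv.subsingleton_congr]
  exact ⟨fun h φ => h.elim _ _, fun h => ⟨fun a b => (h a).trans (h b).symm⟩⟩

lemma extVanish_congr_left (e : X ≃ₗ[A] Y) (i : ℕ) : ExtVanish A X L i ↔ ExtVanish A Y L i := by
  rw [ExtVanish, ExtVanish, ← isZero_Ext_iff_subsingleton, ← isZero_Ext_iff_subsingleton]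
  exact (((Ext A (ModuleCat A) i).mapIso e.toModuleIso.op.symm).app _).isZero_iff

lemma InjDimLE.extVanish {n i : ℕ} (h : InjDimLE A X n) (hi : n < i) : ExtVanish A L X i :=
  HasInjectiveDimensionLT.subsingleton _ (n + 1) i hi _

lemma extVanish_of_injective [h : Module.Injective A X] (i : ℕ) : ExtVanish A L X (i + 1) :=
  (injDimLE_zero_iff.2 h).extVanish (Nat.succ_pos i)

lemma extVanish_of_projective [h : Module.Projective A L] (i : ℕ) : ExtVanish A L X (i + 1) := by
  have := (IsProjective.iff_projective (R := A) L).1 h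
  exact subsingleton_of_forall_eq 0 fun e => e.eq_zero_of_projective

lemma ExtVanish.of_exact_middle_right (hf : Function.Injective f) (hfg : Function.Exact f g)
    (hg : Function.Surjective g) {i : ℕ} (hX : ExtVanish A L X i) (hZ : ExtVanish A L Z i) :
    ExtVanish A L Y i := by
  refine subsingleton_of_forall_eq 0 fun e => ?_
  obtain ⟨e', rfl⟩ := Abelian.Ext.covariant_sequence_exact₂ _ (shortExact_of_linearMap hf hfg hg) e
    (hZ.elim _ _)
  rw [hX.elim e' 0]; simp

lemma ExtVanish.of_exact_left_right (hf : Function.Injective f) (hfg : Function.Exact f g)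
    (hg : Function.Surjective g) {i : ℕ} (hZ : ExtVanish A L Z i) (hY : ExtVanish A L Y (i + 1)) :
    ExtVanish A L X (i + 1) := by
  refine subsingleton_of_forall_eq 0 fun e => ?_
  obtain ⟨e', rfl⟩ := Abelian.Ext.covariant_sequence_exact₁ _ (shortExact_of_linearMap hf hfg hg) e
    (hY.elim _ _) rfl
  rw [hZ.elim e' 0]; simp

lemma ExtVanish.of_exact_right_right (hf : Function.Injective f) (hfg : Function.Exact f g)
    (hg : Function.Surjective g) {i : ℕ} (hY : ExtVanish A L Y i) (hX : ExtVanish A L X (i + 1)) :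
    ExtVanish A L Z i := by
  refine subsingleton_of_forall_eq 0 fun e => ?_
  obtain ⟨e', rfl⟩ := Abelian.Ext.covariant_sequence_exact₃ _ (shortExact_of_linearMap hf hfg hg) e
    rfl (hX.elim _ _)
  rw [hY.elim e' 0]; simp

lemma ExtVanish.of_exact_middle_left (hf : Function.Injective f) (hfg : Function.Exact f g)
    (hg : Function.Surjective g) {i : ℕ} (hX : ExtVanish A X L i) (hZ : ExtVanish A Z L i) :
    ExtVanish A Y L i := by
  refine subsingleton_of_forall_eq 0 fun e => ?_
  obtain ⟨e', rfl⟩ := Abelian.Ext.contravariant_sequence_exact₂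
    (shortExact_of_linearMap hf hfg hg) _ e (hX.elim _ _)
  rw [hZ.elim e' 0]; simp

lemma ExtVanish.of_exact_left_left (hf : Function.Injective f) (hfg : Function.Exact f g)
    (hg : Function.Surjective g) {i : ℕ} (hY : ExtVanish A Y L i) (hZ : ExtVanish A Z L (i + 1)) :
    ExtVanish A X L i := by
  refine subsingleton_of_forall_eq 0 fun e => ?_
  obtain ⟨e', rfl⟩ := Abelian.Ext.contravariant_sequence_exact₁
    (shortExact_of_linearMap hf hfg hg) _ e (add_comm 1 i) (hZ.elim _ _)
  rw [hY.elim e' 0]; simp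

lemma ExtVanish.of_exact_right_left (hf : Function.Injective f) (hfg : Function.Exact f g)
    (hg : Function.Surjective g) {i : ℕ} (hX : ExtVanish A X L i) (hY : ExtVanish A Y L (i + 1)) :
    ExtVanish A Z L (i + 1) := by
  refine subsingleton_of_forall_eq 0 fun e => ?_
  obtain ⟨e', rfl⟩ := Abelian.Ext.contravariant_sequence_exact₃
    (shortExact_of_linearMap hf hfg hg) _ e (hY.elim _ _) (add_comm 1 i)
  rw [hX.elim e' 0]; simp

lemma extVanish_add_two_iff (hf : Function.Injective f) (hfg : Function.Exact f g)
    (hg : Function.Surjective g) [Module.Injective A Y] (i : ℕ) :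
    ExtVanish A L X (i + 2) ↔ ExtVanish A L Z (i + 1) :=
  ⟨.of_exact_right_right hf hfg hg (extVanish_of_injective i),
    fun h => .of_exact_left_right hf hfg hg h (extVanish_of_injective _)⟩

lemma extVanish_succ_iff (hf : Function.Injective f) (hfg : Function.Exact f g)
    (hg : Function.Surjective g) [Module.Injective A X] (i : ℕ) :
    ExtVanish A L Y (i + 1) ↔ ExtVanish A L Z (i + 1) :=
  ⟨fun h => .of_exact_right_right hf hfg hg h (extVanish_of_injective _),
    fun h => .of_exact_middle_right hf hfg hg (extVanish_of_injective _) h⟩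

lemma ExtVanish.exists_lift (hf : Function.Injective f) (hfg : Function.Exact f g)
    (hg : Function.Surjective g) (h : ExtVanish A L X 1) (φ : L →ₗ[A] Z) :
    ∃ ψ : L →ₗ[A] Y, g ∘ₗ ψ = φ := by
  obtain ⟨e', he⟩ := Abelian.Ext.covariant_sequence_exact₃ _ (shortExact_of_linearMap hf hfg hg)
    (Abelian.Ext.mk₀ (ModuleCat.ofHom φ)) (zero_add 1) (h.elim _ _)
  obtain ⟨ψ, rfl⟩ := Abelian.Ext.homEquiv₀.symm.surjective e'
  refine ⟨ψ.hom, ?_⟩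
  have h2 : ψ ≫ ModuleCat.ofHom g = ModuleCat.ofHom φ :=
    Abelian.Ext.homEquiv₀.symm.injective (by simpa using he)
  exact congrArg ModuleCat.Hom.hom h2

lemma ExtVanish.exists_extend (hf : Function.Injective f) (hfg : Function.Exact f g)
    (hg : Function.Surjective g) (h : ExtVanish A Z L 1) (φ : X →ₗ[A] L) :
    ∃ ψ : Y →ₗ[A] L, ψ ∘ₗ f = φ := by
  obtain ⟨e', he⟩ := Abelian.Ext.contravariant_sequence_exact₁ (shortExact_of_linearMap hf hfg hg) _
    (Abelian.Ext.mk₀ (ModuleCat.ofHom φ)) (zero_add 1) (h.elim _ _)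
  obtain ⟨ψ, rfl⟩ := Abelian.Ext.homEquiv₀.symm.surjective e'
  refine ⟨ψ.hom, ?_⟩
  have h2 : ModuleCat.ofHom f ≫ ψ = ModuleCat.ofHom φ :=
    Abelian.Ext.homEquiv₀.symm.injective (by simpa using he)
  exact congrArg ModuleCat.Hom.hom h2

lemma extVanish_one_iff (hf : Function.Injective f) (hfg : Function.Exact f g)
    (hg : Function.Surjective g) [Module.Injective A Y] :
    ExtVanish A L X 1 ↔ ∀ φ : L →ₗ[A] Z, ∃ ψ : L →ₗ[A] Y, g ∘ₗ ψ = φ := by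
  refine ⟨fun h => h.exists_lift hf hfg hg, fun h => subsingleton_of_forall_eq 0 fun e => ?_⟩
  have hY : ExtVanish A L Y 1 := extVanish_of_injective 0
  obtain ⟨e', rfl⟩ := Abelian.Ext.covariant_sequence_exact₁ _ (shortExact_of_linearMap hf hfg hg) e
    (hY.elim _ _) rfl
  obtain ⟨φ, rfl⟩ := Abelian.Ext.homEquiv₀.symm.surjective e'
  obtain ⟨ψ, hψ⟩ := h φ.hom
  have h2 : φ = ModuleCat.ofHom ψ ≫
      (ModuleCat.shortComplexOfCompEqZero f g hfg.linearMap_comp_eq_zero).g := by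
    ext x; exact (LinearMap.congr_fun hψ x).symm
  rw [h2, Abelian.Ext.homEquiv₀_symm_apply, ← Abelian.Ext.mk₀_comp_mk₀]
  have h3 := (shortExact_of_linearMap hf hfg hg).comp_extClass
  exact (Abelian.Ext.comp_assoc _ _ _ (zero_add 0) (zero_add 1) (by omega)).trans
    (by rw [h3, Abelian.Ext.comp_zero])

end ExtVanish

section Torsion

variable {A L M N C : Type} [CommRing A] (J : Ideal A) [AddCommGroup L] [Module A L]
  [Module (A ⧸ J) L] [IsScalarTower A (A ⧸ J) L] [AddCommGroup M] [Module A M]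
  [AddCommGroup N] [Module A N] [AddCommGroup C] [Module A C]

/-- The submodule of elements of `M` annihilated by `J`, as a module over `A ⧸ J`. -/
abbrev TorsionOf (M : Type) [AddCommGroup M] [Module A M] : Type :=
  Submodule.torsionBySet A M (J : Set A)

/-- A linear map from an `A ⧸ J`-module takes values in the `J`-torsion. -/
def toTorsion (φ : L →ₗ[A] M) : L →ₗ[A ⧸ J] TorsionOf J M where
  toFun x := ⟨φ x, (Submodule.mem_torsionBySet_iff _ _).2 fun a => by
    rw [← map_smul, ← algebraMap_smul (A ⧸ J) (a : A) x]
    have : algebraMap A (A ⧸ J) a = 0 := Ideal.Quotient.eq_zero_iff_mem.2 a.2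
    rw [this, zero_smul, map_zero]⟩
  map_add' x y := Subtype.ext (map_add φ x y)
  map_smul' r x := by
    obtain ⟨r, rfl⟩ := Ideal.Quotient.mk_surjective r
    refine Subtype.ext ?_
    have : Ideal.Quotient.mk J r • x = r • x := algebraMap_smul (A ⧸ J) r x
    rw [RingHom.id_apply, Submodule.torsionBySet.mk_smul, this]
    exact map_smul φ r x

@[simp] lemma coe_toTorsion (φ : L →ₗ[A] M) (x : L) : (toTorsion J φ x : M) = φ x := rfl

/-- The map induced on `J`-torsion. -/
def torsionMap (f : M →ₗ[A] N) : TorsionOf J M →ₗ[A ⧸ J] TorsionOf J N :=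
  toTorsion J (f ∘ₗ Submodule.subtype _)

@[simp] lemma coe_torsionMap (f : M →ₗ[A] N) (x : TorsionOf J M) :
    (torsionMap J f x : N) = f x := rfl

lemma smul_coe_torsion {a : A} (ha : a ∈ J) (x : TorsionOf J M) : a • (x : M) = 0 :=
  (Submodule.mem_torsionBySet_iff _ _).1 x.2 ⟨a, ha⟩

/-- A linear map into the `J`-torsion, as a map into the ambient module. -/
def ofTorsion (φ : L →ₗ[A ⧸ J] TorsionOf J M) : L →ₗ[A] M :=
  (Submodule.subtype _) ∘ₗ (φ.restrictScalars A)

instance injective_torsionOf [Module.Injective A M] :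
    Module.Injective (A ⧸ J) (TorsionOf J M) := by
  refine Module.Baer.injective fun I g => ?_
  obtain ⟨h, hh⟩ := Module.Injective.out (I.subtype.restrictScalars A) I.injective_subtype
    (ofTorsion J g)
  exact ⟨toTorsion J h, fun x hx => Subtype.ext (hh ⟨x, hx⟩)⟩

lemma extVanish_congr_right {A X Y L : Type} [CommRing A] [AddCommGroup X] [Module A X]
    [AddCommGroup Y] [Module A Y] [AddCommGroup L] [Module A L] (e : X ≃ₗ[A] Y) (i : ℕ) :
    ExtVanish A L X i ↔ ExtVanish A L Y i := by
  rw [ExtVanish, ExtVanish, ← isZero_Ext_iff_subsingleton, ← isZero_Ext_iff_subsingleton]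
  exact (((Ext A (ModuleCat A) i).obj (Opposite.op (ModuleCat.of A L))).mapIso
    e.toModuleIso).isZero_iff

lemma torsionMap_injective {f : M →ₗ[A] N} (hf : Function.Injective f) :
    Function.Injective (torsionMap J f) :=
  fun _ _ h => Subtype.ext (hf (congrArg Subtype.val h))

lemma torsionMap_exact {f : M →ₗ[A] N} {g : N →ₗ[A] C} (hf : Function.Injective f)
    (hfg : Function.Exact f g) : Function.Exact (torsionMap J f) (torsionMap J g) := by
  intro x
  constructor
  · intro hx
    obtain ⟨m, hm⟩ := (hfg x).1 (congrArg Subtype.val hx)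
    refine ⟨⟨m, (Submodule.mem_torsionBySet_iff _ _).2 fun a => hf ?_⟩, Subtype.ext hm⟩
    rw [map_smul, hm, smul_coe_torsion J a.2, map_zero]
  · rintro ⟨m, rfl⟩
    exact Subtype.ext (hfg.apply_apply_eq_zero m)

end Torsion

section Rees

variable {A : Type} [CommRing A] {y : A}

lemma mem_torsion_span {M : Type} [AddCommGroup M] [Module A M] {x : M} :
    x ∈ Submodule.torsionBySet A M (Ideal.span {y} : Set A) ↔ y • x = 0 := by
  rw [Submodule.torsionBySet_ideal_span_singleton_eq, Submodule.mem_torsionBy_iff]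

lemma exists_smul_eq_of_injective {I : Type} [AddCommGroup I] [Module A I] [Module.Injective A I]
    (hy : y ∈ nonZeroDivisors A) (x : I) : ∃ z, y • z = x := by
  obtain ⟨h, hh⟩ := Module.Injective.out (LinearMap.mulLeft A y)
    (fun a b hab => (mul_cancel_left_mem_nonZeroDivisors hy).1 hab) (LinearMap.toSpanSingleton A I x)
  refine ⟨h 1, ?_⟩
  simpa [← map_smul] using hh 1

lemma torsionMap_surjective {M N C : Type} [AddCommGroup M] [Module A M] [AddCommGroup N]
    [Module A N] [AddCommGroup C] [Module A C] {f : M →ₗ[A] N} {g : N →ₗ[A] C}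
    (hfg : Function.Exact f g) (hg : Function.Surjective g) (hM : ∀ x : M, ∃ z, y • z = x) :
    Function.Surjective (torsionMap (Ideal.span {y}) g) := by
  rintro ⟨c, hc⟩
  obtain ⟨u, rfl⟩ := hg c
  rw [mem_torsion_span, ← map_smul] at hc
  obtain ⟨m, hm⟩ := (hfg _).1 hc
  obtain ⟨z, rfl⟩ := hM m
  refine ⟨⟨u - f z, mem_torsion_span.2 ?_⟩, Subtype.ext ?_⟩
  · rw [smul_sub, ← map_smul, hm, sub_self]
  · simp [hfg.apply_apply_eq_zero]

variable {L : Type} [AddCommGroup L] [Module A L] [Module (A ⧸ Ideal.span {y}) L]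
  [IsScalarTower A (A ⧸ Ideal.span {y}) L]

lemma extVanish_torsion_iff (hy : y ∈ nonZeroDivisors A) (i : ℕ) {M : Type} [AddCommGroup M]
    [Module A M] (hM : ∀ x : M, ∃ z, y • z = x) :
    ExtVanish A L M i ↔ ExtVanish (A ⧸ Ideal.span {y}) L (TorsionOf (Ideal.span {y}) M) i := by
  induction i generalizing M with
  | zero =>
    rw [extVanish_zero_iff, extVanish_zero_iff]
    refine ⟨fun h φ => ?_, fun h φ => ?_⟩
    · ext x; exact LinearMap.congr_fun (h (ofTorsion _ φ)) x
    · ext x; exact congrArg Subtype.val (LinearMap.congr_fun (h (toTorsion _ φ)) x)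
  | succ i ih =>
    obtain ⟨I, _, _, _, f, hf⟩ := exists_injective_embedding A M
    have hfg := LinearMap.exact_map_mkQ_range f
    have hg := Submodule.mkQ_surjective (LinearMap.range f)
    have hf' := torsionMap_injective (Ideal.span {y}) hf
    have hfg' := torsionMap_exact (Ideal.span {y}) hf hfg
    have hg' := torsionMap_surjective hfg hg hM
    cases i with
    | zero =>
      rw [extVanish_one_iff hf hfg hg, extVanish_one_iff hf' hfg' hg']
      refine ⟨fun h φ => ?_, fun h φ => ?_⟩
      · obtain ⟨ψ, hψ⟩ := h (ofTorsion _ φ)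
        refine ⟨toTorsion _ ψ, ?_⟩
        ext x; exact LinearMap.congr_fun hψ x
      · obtain ⟨ψ, hψ⟩ := h (toTorsion _ φ)
        refine ⟨ofTorsion _ ψ, ?_⟩
        ext x; exact congrArg Subtype.val (LinearMap.congr_fun hψ x)
    | succ i =>
      rw [extVanish_add_two_iff hf hfg hg, extVanish_add_two_iff hf' hfg' hg']
      refine ih fun x => ?_
      obtain ⟨u, rfl⟩ := hg x
      obtain ⟨z, rfl⟩ := exists_smul_eq_of_injective hy u
      exact ⟨_, (map_smul _ _ _).symm⟩

/-- If `0 → A → I → C → 0` is exact with `I` injective then the `y`-torsion of `C` is the sum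
of the `y`-torsion of `I` and a copy of `A ⧸ (y)`. -/
lemma exists_torsion_equiv_prod (hy : y ∈ nonZeroDivisors A) {I C : Type} [AddCommGroup I]
    [Module A I] [Module.Injective A I] [AddCommGroup C] [Module A C]
    {f : A →ₗ[A] I} {g : I →ₗ[A] C} (hf : Function.Injective f)
    (hfg : Function.Exact f g) (hg : Function.Surjective g) :
    ∃ e : (TorsionOf (Ideal.span {y}) I × (A ⧸ Ideal.span {y})) ≃ₗ[A ⧸ Ideal.span {y}]
      TorsionOf (Ideal.span {y}) C, ∀ w, e (w, 0) = torsionMap (Ideal.span {y}) g w := by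
  obtain ⟨u, hu⟩ := exists_smul_eq_of_injective hy (f 1)
  have hf1 (a : A) : f a = a • f 1 := by rw [← map_smul, smul_eq_mul, mul_one]
  have hyu (a : A) : a • y • u = f a := by rw [hu, hf1 a]
  let c : TorsionOf (Ideal.span {y}) C :=
    ⟨g u, mem_torsion_span.2 (by rw [← map_smul, hu, hfg.apply_apply_eq_zero])⟩
  let s := LinearMap.toSpanSingleton (A ⧸ Ideal.span {y}) _ c
  have hs (a : A) : ((s (Ideal.Quotient.mk _ a) : TorsionOf (Ideal.span {y}) C) : C) =
      g (a • u) := by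
    rw [map_smul]; rfl
  let Φ := (torsionMap (Ideal.span {y}) g).coprod s
  refine ⟨LinearEquiv.ofBijective Φ ⟨?_, ?_⟩, fun w => ?_⟩
  · rw [injective_iff_map_eq_zero]
    rintro ⟨w, a⟩ h
    obtain ⟨a, rfl⟩ := Ideal.Quotient.mk_surjective a
    have h1 : g (w + a • u) = 0 := by
      rw [map_add, ← hs]; exact congrArg Subtype.val h
    obtain ⟨b, hb⟩ := (hfg _).1 h1
    have hw : y • (w : I) = 0 := mem_torsion_span.1 w.2
    have h2 : a = y * b := hf (by
      rw [← smul_eq_mul, map_smul, hb, smul_add, hw, zero_add, smul_comm, hyu])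
    have ha : Ideal.Quotient.mk (Ideal.span {y}) a = 0 :=
      Ideal.Quotient.eq_zero_iff_mem.2 (Ideal.mem_span_singleton.2 ⟨b, h2⟩)
    have hw0 : (w : I) = 0 := by
      rw [h2, mul_comm, mul_smul, hyu] at hb
      simpa using hb
    rw [ha, Prod.mk_eq_zero]
    exact ⟨Subtype.ext hw0, rfl⟩
  · rintro ⟨z, hz⟩
    obtain ⟨v, rfl⟩ := hg z
    rw [mem_torsion_span, ← map_smul] at hz
    obtain ⟨a, ha⟩ := (hfg _).1 hz
    refine ⟨(⟨v - a • u, mem_torsion_span.2 ?_⟩, Ideal.Quotient.mk _ a), Subtype.ext ?_⟩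
    · rw [smul_sub, smul_comm, hyu, ha, sub_self]
    · have : ((Φ (⟨v - a • u, mem_torsion_span.2 (by rw [smul_sub, smul_comm, hyu, ha, sub_self])⟩,
        Ideal.Quotient.mk _ a) : TorsionOf (Ideal.span {y}) C) : C) = g (v - a • u) + g (a • u) := by
        rw [← hs]; rfl
      rw [this, ← map_add, sub_add_cancel]
  · have : Φ (w, 0) = torsionMap (Ideal.span {y}) g w := by
      rw [LinearMap.coprod_apply, map_zero, add_zero]
    exact this

/-- Rees's change of rings: dividing by a nonzerodivisor shifts `Ext` by one. -/
lemma extVanish_rees (hy : y ∈ nonZeroDivisors A) (i : ℕ) :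
    ExtVanish A L A (i + 1) ↔ ExtVanish (A ⧸ Ideal.span {y}) L (A ⧸ Ideal.span {y}) i := by
  obtain ⟨I, _, _, _, f, hf⟩ := exists_injective_embedding A A
  have hfg := LinearMap.exact_map_mkQ_range f
  have hg := Submodule.mkQ_surjective (LinearMap.range f)
  obtain ⟨e, he⟩ := exists_torsion_equiv_prod hy hf hfg hg
  cases i with
  | zero =>
    rw [extVanish_one_iff hf hfg hg, extVanish_zero_iff]
    refine ⟨fun h φ => ?_, fun h φ => ?_⟩
    · obtain ⟨ψ, hψ⟩ := h (ofTorsion _ (e.toLinearMap ∘ₗ LinearMap.inr _ _ _ ∘ₗ φ))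
      ext x
      have h1 : e (toTorsion _ ψ x, 0) = e (0, φ x) := by
        rw [he]; exact Subtype.ext (LinearMap.congr_fun hψ x)
      exact (congrArg Prod.snd (e.injective h1)).symm
    · let φ' := e.symm.toLinearMap ∘ₗ toTorsion (Ideal.span {y}) φ
      refine ⟨ofTorsion _ (LinearMap.fst _ _ _ ∘ₗ φ'), ?_⟩
      ext x
      have h1 : (φ' x).2 = 0 := LinearMap.congr_fun (h (LinearMap.snd _ _ _ ∘ₗ φ')) x
      have h2 : e ((φ' x).1, 0) = toTorsion (Ideal.span {y}) φ x := by
        rw [← h1]; exact e.apply_symm_apply _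
      rw [he] at h2
      exact congrArg Subtype.val h2
  | succ i =>
    rw [extVanish_add_two_iff hf hfg hg, extVanish_torsion_iff hy, ← extVanish_congr_right e]
    · exact extVanish_succ_iff LinearMap.inl_injective .inl_snd LinearMap.snd_surjective i
    · intro x
      obtain ⟨u, rfl⟩ := hg x
      obtain ⟨z, rfl⟩ := exists_smul_eq_of_injective hy u
      exact ⟨_, (map_smul _ _ _).symm⟩

/-- Dividing by a nonzerodivisor lowers the self-injective dimension. -/
lemma InjDimLE.quotient (hy : y ∈ nonZeroDivisors A) {n : ℕ} (h : InjDimLE A A (n + 1)) :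
    InjDimLE (A ⧸ Ideal.span {y}) (A ⧸ Ideal.span {y}) n := by
  refine hasInjectiveDimensionLT_of_enoughProjectives _ _ fun Y => ?_
  let _ : Module A Y := Module.compHom Y (algebraMap A (A ⧸ Ideal.span {y}))
  have : IsScalarTower A (A ⧸ Ideal.span {y}) Y := ⟨fun a b m => by
    rw [Algebra.smul_def, mul_smul]; rfl⟩
  exact (extVanish_rees hy (L := Y) (n + 1)).1 (h.extVanish (Nat.lt_succ_self _))

end Rees

section Bass

variable {A N : Type} [CommRing A] [AddCommGroup N] [Module A N]

lemma injDimLE_of_extVanish_ideal {n : ℕ} (h : ∀ I : Ideal A, ExtVanish A (A ⧸ I) N (n + 1)) :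
    InjDimLE A N n := by
  induction n generalizing N with
  | zero =>
    rw [injDimLE_zero_iff]
    refine Module.Baer.injective fun I g => ?_
    obtain ⟨ψ, hψ⟩ := (h I).exists_extend I.injective_subtype
      (LinearMap.exact_subtype_mkQ I) (Submodule.mkQ_surjective I) g
    exact ⟨ψ, fun x hx => LinearMap.congr_fun hψ ⟨x, hx⟩⟩
  | succ n ih =>
    obtain ⟨I, _, _, _, f, hf⟩ := exists_injective_embedding A N
    have hfg := LinearMap.exact_map_mkQ_range f
    have hg := Submodule.mkQ_surjective (LinearMap.range f)
    rw [injDimLE_succ_iff hf hfg hg]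
    exact ih fun I => (extVanish_add_two_iff hf hfg hg n).1 (h I)

lemma exists_injective_residueField [IsLocalRing A] {s : N} (hs : s ≠ 0)
    (hms : ∀ t ∈ IsLocalRing.maximalIdeal A, t • s = 0) :
    ∃ f : (A ⧸ IsLocalRing.maximalIdeal A) →ₗ[A] N, Function.Injective f := by
  refine ⟨(IsLocalRing.maximalIdeal A).liftQ (LinearMap.toSpanSingleton A N s) hms, ?_⟩
  rw [← LinearMap.ker_eq_bot]
  refine Submodule.ker_liftQ_eq_bot _ _ _ fun t ht => ?_
  by_contra htm
  have hu : IsUnit t := by simpa using htm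
  exact hs ((hu.smul_eq_zero).1 ht)

variable [IsNoetherianRing A] [IsLocalRing A]

lemma extVanish_of_smul_surjective [Module.Finite A N] {p : Ideal A} [p.IsPrime] {t : A}
    (ht : t ∈ IsLocalRing.maximalIdeal A) (htp : t ∉ p) {i : ℕ}
    (h : ∀ (L : Type) [AddCommGroup L] [Module A L], ExtVanish A L N (i + 1)) :
    ExtVanish A (A ⧸ p) N i := by
  let f : (A ⧸ p) →ₗ[A] (A ⧸ p) := t • LinearMap.id
  have hf : Function.Injective f := by
    rw [injective_iff_map_eq_zero]
    intro x hx
    have h1 : Ideal.Quotient.mk p t * x = 0 := hx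
    exact (mul_eq_zero.1 h1).resolve_left (Ideal.Quotient.eq_zero_iff_mem.not.2 htp)
  have hfg := LinearMap.exact_map_mkQ_range f
  have hg := Submodule.mkQ_surjective (LinearMap.range f)
  have hs : ∀ e : Abelian.Ext.{0} (ModuleCat.of A (A ⧸ p)) (ModuleCat.of A N) i,
      ∃ e', t • e' = e := by
    intro e
    obtain ⟨e', rfl⟩ := Abelian.Ext.contravariant_sequence_exact₁
      (shortExact_of_linearMap hf hfg hg) _ e (add_comm 1 i) ((h _).elim _ _)
    refine ⟨e', ?_⟩
    have : ModuleCat.ofHom f = t • 𝟙 (ModuleCat.of A (A ⧸ p)) := rfl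
    change _ = (Abelian.Ext.mk₀ (ModuleCat.ofHom f)).comp e' _
    rw [this, Abelian.Ext.mk₀_smul, Abelian.Ext.smul_comp, Abelian.Ext.mk₀_id_comp]
  have hfin : Module.Finite A (Abelian.Ext.{0} (ModuleCat.of A (A ⧸ p)) (ModuleCat.of A N) i) :=
    ModuleCat.finite_ext _ _ _ i
  rw [ExtVanish, ← Submodule.subsingleton_iff A]
  refine subsingleton_of_bot_eq_top (Eq.symm ?_)
  refine Submodule.eq_bot_of_le_smul_of_le_jacobson_bot (Ideal.span {t}) ⊤ hfin.fg_top ?_ ?_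
  · intro e _
    obtain ⟨e', rfl⟩ := hs e
    exact Submodule.smul_mem_smul (Ideal.mem_span_singleton_self t) trivial
  · rw [IsLocalRing.jacobson_eq_maximalIdeal _ bot_ne_top, Ideal.span_singleton_le_iff_mem]
    exact ht

/-- Over a noetherian local ring the injective dimension of a finite module drops as soon as the
top `Ext` from the residue field vanishes. -/
lemma InjDimLE.of_extVanish_residueField [Module.Finite A N] {n : ℕ} (h : InjDimLE A N (n + 1))
    (hk : ExtVanish A (A ⧸ IsLocalRing.maximalIdeal A) N (n + 1)) : InjDimLE A N n := by
  suffices H : ∀ (L : Type) [AddCommGroup L] [Module A L] [Module.Finite A L],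
      ExtVanish A L N (n + 1) from injDimLE_of_extVanish_ideal fun I => H _
  intro L _ _ hfin
  induction hfin using IsNoetherianRing.induction_on_isQuotientEquivQuotientPrime A with
  | subsingleton L =>
    exact (extVanish_congr_left (Y := PUnit) 0 _).2 (extVanish_of_projective n)
  | quotient L p e =>
    rw [extVanish_congr_left e]
    have := p.2
    by_cases hp : p.1 = IsLocalRing.maximalIdeal A
    · rwa [hp]
    · obtain ⟨t, ht, htp⟩ := SetLike.exists_of_lt
        (lt_of_le_of_ne (IsLocalRing.le_maximalIdeal p.2.ne_top) hp)
      exact extVanish_of_smul_surjective ht htp fun L _ _ => h.extVanish (Nat.lt_succ_self _)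
  | exact N₁ N₂ N₃ f g hf hg hfg h₁ h₃ => exact h₁.of_exact_middle_left hf hfg hg h₃

lemma InjDimLE.of_residueField_embedding {n : ℕ} (h : InjDimLE A A (n + 1)) {s : N} (hs : s ≠ 0)
    (hms : ∀ t ∈ IsLocalRing.maximalIdeal A, t • s = 0) (hN : ExtVanish A N A (n + 1)) :
    InjDimLE A A n := by
  obtain ⟨f, hf⟩ := exists_injective_residueField hs hms
  exact h.of_extVanish_residueField (hN.of_exact_left_left hf (LinearMap.exact_map_mkQ_range f)
    (Submodule.mkQ_surjective _) (h.extVanish (Nat.lt_succ_self _)))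

lemma InjDimLE.zero_of_socle {n : ℕ} (h : InjDimLE A A n) {s : A} (hs : s ≠ 0)
    (hms : ∀ t ∈ IsLocalRing.maximalIdeal A, t * s = 0) : InjDimLE A A 0 := by
  induction n with
  | zero => exact h
  | succ n ih => exact ih (h.of_residueField_embedding hs hms (extVanish_of_projective n))

lemma InjDimLE.one_of_socle_quotient {n : ℕ} (h : InjDimLE A A n) {y b : A}
    (hy : y ∈ nonZeroDivisors A) (hb : b ∉ Ideal.span {y})
    (hmb : ∀ t ∈ IsLocalRing.maximalIdeal A, t * b ∈ Ideal.span {y}) : InjDimLE A A 1 := by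
  induction n with
  | zero => exact h.mono (by omega)
  | succ n ih =>
    cases n with
    | zero => exact h
    | succ n =>
      refine ih (h.of_residueField_embedding (N := A ⧸ Ideal.span {y})
        (Ideal.Quotient.eq_zero_iff_mem.not.2 hb)
        (fun t ht => Ideal.Quotient.eq_zero_iff_mem.2 (hmb t ht)) ?_)
      have hf : Function.Injective (LinearMap.mulLeft A y) :=
        fun a b hab => (mul_cancel_left_mem_nonZeroDivisors hy).1 hab
      have hr : LinearMap.range (LinearMap.mulLeft A y) = Ideal.span {y} := by
        ext x; simp [Ideal.mem_span_singleton, Dvd.dvd, eq_comm]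
      have hex : Function.Exact (LinearMap.mulLeft A y) (Submodule.mkQ (Ideal.span {y})) := by
        rw [LinearMap.exact_iff, Submodule.ker_mkQ, hr]
      exact (extVanish_of_projective n).of_exact_right_left hf hex (Submodule.mkQ_surjective _)
        (extVanish_of_projective _)

end Bass

section SelfInjective

variable {A : Type} [CommRing A]

lemma mem_associatedPrimes_self_iff [IsNoetherianRing A] {p : Ideal A} :
    p ∈ associatedPrimes A A ↔ p.IsPrime ∧ ∃ x, ∀ t, t ∈ p ↔ t * x = 0 := by
  rw [AssociatedPrimes.mem_iff, isAssociatedPrime_iff]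
  simp [SetLike.ext_iff, Submodule.mem_colon_singleton]

lemma exists_mem_associatedPrimes_of_forall_notMem [IsNoetherianRing A] {I : Ideal A}
    (hI : ∀ t ∈ I, t ∉ nonZeroDivisors A) : ∃ p ∈ associatedPrimes A A, I ≤ p := by
  have hfin := associatedPrimes.finite A A
  have h : (I : Set A) ⊆ ⋃ p ∈ (hfin.toFinset : Set (Ideal A)), (p : Set A) := by
    rw [hfin.coe_toFinset, biUnion_associatedPrimes_eq_compl_nonZeroDivisors]
    exact hI
  obtain ⟨p, hp, hIp⟩ := (Ideal.subset_union_prime (f := id) ⊤ ⊤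
    (fun p hp _ _ => (hfin.mem_toFinset.1 hp).isPrime)).1 h
  exact ⟨p, hfin.mem_toFinset.1 hp, hIp⟩

lemma exists_socle_of_forall_notMem [IsNoetherianRing A] {I : Ideal A}
    (hI : ∀ t ∈ I, t ∉ nonZeroDivisors A) : ∃ s : A, s ≠ 0 ∧ ∀ t ∈ I, t * s = 0 := by
  obtain ⟨p, hp, hIp⟩ := exists_mem_associatedPrimes_of_forall_notMem hI
  obtain ⟨hp, x, hx⟩ := mem_associatedPrimes_self_iff.1 hp
  refine ⟨x, fun h0 => hp.ne_top ((Ideal.eq_top_iff_one p).2 ((hx 1).2 (by simp [h0]))),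
    fun t ht => (hx t).1 (hIp ht)⟩

variable [IsNoetherianRing A] [IsLocalRing A] [Module.Injective A A]

lemma exists_socle_of_injective :
    ∃ s : A, s ≠ 0 ∧ ∀ t ∈ IsLocalRing.maximalIdeal A, t * s = 0 := by
  refine exists_socle_of_forall_notMem fun t ht htn => ?_
  obtain ⟨z, hz⟩ := exists_smul_eq_of_injective htn (1 : A)
  exact ht (IsUnit.of_mul_eq_one z hz)

/-- Ideals of a self-injective local ring are annihilators. -/
lemma exists_annihilator_separating {K : Ideal A} {x : A} (hx : x ∉ K) :
    ∃ c, (∀ k ∈ K, k * c = 0) ∧ x * c ≠ 0 := by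
  obtain ⟨s, hs, hms⟩ := exists_socle_of_injective (A := A)
  let e := LinearMap.toSpanSingleton A (A ⧸ K) (Ideal.Quotient.mk K x)
  let K' : Ideal A := LinearMap.ker e
  have hK' : K' ≤ IsLocalRing.maximalIdeal A := by
    refine IsLocalRing.le_maximalIdeal fun h => hx ?_
    have h1 : e 1 = 0 := by
      have : (1 : A) ∈ K' := h ▸ Submodule.mem_top
      exact this
    rw [LinearMap.toSpanSingleton_apply, one_smul] at h1
    exact Ideal.Quotient.eq_zero_iff_mem.1 h1
  let f := K'.liftQ e le_rfl
  have hf : Function.Injective f := LinearMap.ker_eq_bot.1 (Submodule.ker_liftQ_eq_bot _ _ _ le_rfl)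
  let g : (A ⧸ K') →ₗ[A] A := K'.liftQ (LinearMap.toSpanSingleton A A s) fun t ht => hms t (hK' ht)
  obtain ⟨h, hh⟩ := Module.Injective.out f hf g
  have hh1 (r : A) : h (Ideal.Quotient.mk K r) = r * h 1 := by
    rw [← smul_eq_mul, ← map_smul, Algebra.smul_def, mul_one]; rfl
  refine ⟨h 1, fun k hk => ?_, ?_⟩
  · rw [← hh1, Ideal.Quotient.eq_zero_iff_mem.2 hk, map_zero]
  · have h2 : h (f (Ideal.Quotient.mk K' 1)) = g (Ideal.Quotient.mk K' 1) := hh _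
    have h3 : f (Ideal.Quotient.mk K' 1) = Ideal.Quotient.mk K x := one_smul A (Ideal.Quotient.mk K x)
    have h4 : g (Ideal.Quotient.mk K' 1) = s := one_smul A _
    rwa [← hh1, ← h3, h2, h4]

lemma isArtinianRing_of_injective : IsArtinianRing A := by
  let F : Ideal A → Ideal A := fun K => Submodule.annihilator K
  have hF : StrictAnti F := by
    intro K K' hlt
    refine lt_of_le_of_ne (Submodule.annihilator_mono hlt.le) fun heq => ?_
    obtain ⟨x, hx, hxK⟩ := SetLike.exists_of_lt hlt
    obtain ⟨c, hc, hcx⟩ := exists_annihilator_separating hxK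
    have h1 : c ∈ F K := Submodule.mem_annihilator.2 fun k hk => by
      rw [smul_eq_mul, mul_comm]; exact hc k hk
    rw [← heq] at h1
    exact hcx (by rw [mul_comm]; exact Submodule.mem_annihilator.1 h1 x hx)
  exact hF.wellFoundedLT

lemma exists_maximalIdeal_pow_eq_bot : ∃ n, IsLocalRing.maximalIdeal A ^ n = ⊥ := by
  have := isArtinianRing_of_injective (A := A)
  obtain ⟨n, hn⟩ := IsArtinianRing.isNilpotent_jacobson_bot (R := A)
  exact ⟨n, by rwa [IsLocalRing.jacobson_eq_maximalIdeal _ bot_ne_top] at hn⟩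

lemma exists_mul_eq_socle {s x : A}
    (hms : ∀ t ∈ IsLocalRing.maximalIdeal A, t * s = 0) (hx : x ≠ 0) : ∃ r, r * x = s := by
  suffices h : s ∈ Ideal.span {x} from Ideal.mem_span_singleton'.1 h
  by_contra hsx
  obtain ⟨c, hc, hcs⟩ := exists_annihilator_separating hsx
  have hcu : IsUnit c := by
    by_contra hcm
    exact hcs (by rw [mul_comm]; exact hms c hcm)
  exact hx (hcu.mul_left_eq_zero.1 (hc x (Ideal.mem_span_singleton_self x)))

/-- If a self-injective local ring `A` surjects onto a self-injective local ring `B`, the kernel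
is the annihilator of an element `a` which generates the annihilator of the kernel. -/
lemma exists_generator_annihilator {B : Type} [CommRing B] [IsNoetherianRing B] [IsLocalRing B]
    [Module.Injective B B] (f : A →+* B) (hf : Function.Surjective f) :
    ∃ a, (∀ x, x * a = 0 ↔ f x = 0) ∧ ∀ c, (∀ k, f k = 0 → k * c = 0) → a ∣ c := by
  suffices h : ∃ a, ∀ x, x * a = 0 ↔ f x = 0 by
    obtain ⟨a, ha⟩ := h
    refine ⟨a, ha, fun c hc => ?_⟩
    by_contra hac
    rw [← Ideal.mem_span_singleton] at hac
    obtain ⟨d, hd, hcd⟩ := exists_annihilator_separating hac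
    refine hcd ?_
    rw [mul_comm]
    exact hc d ((ha d).1 (by rw [mul_comm]; exact hd a (Ideal.mem_span_singleton_self a)))
  obtain ⟨s, hs, hms⟩ := exists_socle_of_injective (A := A)
  obtain ⟨s', hs', hms'⟩ := exists_socle_of_injective (A := B)
  obtain ⟨σ, rfl⟩ := hf s'
  have hloc : IsLocalHom f := .of_surjective f hf
  let K := RingHom.ker f
  have hmσ (t : A) (ht : t ∈ IsLocalRing.maximalIdeal A) : t * σ ∈ K := by
    rw [RingHom.mem_ker, map_mul]
    exact hms' _ (fun hu => ht ((isUnit_map_iff f t).1 hu))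
  let φ : (A ⧸ IsLocalRing.maximalIdeal A) →ₗ[A] A ⧸ K :=
    (IsLocalRing.maximalIdeal A).liftQ
      (LinearMap.toSpanSingleton A (A ⧸ K) (Ideal.Quotient.mk K σ))
      fun t ht => Ideal.Quotient.eq_zero_iff_mem.2 (hmσ t ht)
  have hφ : Function.Injective φ := by
    refine LinearMap.ker_eq_bot.1 (Submodule.ker_liftQ_eq_bot _ _ _ fun t ht => ?_)
    have h1 : t * σ ∈ K := Ideal.Quotient.eq_zero_iff_mem.1 ht
    intro htu
    refine hs' ((htu.map f).mul_right_eq_zero.1 ?_)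
    rw [← map_mul]; exact h1
  let ψ : (A ⧸ IsLocalRing.maximalIdeal A) →ₗ[A] A :=
    (IsLocalRing.maximalIdeal A).liftQ (LinearMap.toSpanSingleton A A s) hms
  obtain ⟨h, hh⟩ := Module.Injective.out φ hφ ψ
  have hh1 (r : A) : h (Ideal.Quotient.mk K r) = r * h 1 := by
    rw [← smul_eq_mul, ← map_smul, Algebra.smul_def, mul_one]; rfl
  have hσ : σ * h 1 = s := by
    have h2 : h (φ (Ideal.Quotient.mk _ 1)) = ψ (Ideal.Quotient.mk _ 1) := hh _
    have h3 : φ (Ideal.Quotient.mk _ 1) = Ideal.Quotient.mk K σ :=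
      one_smul A (Ideal.Quotient.mk K σ)
    have h4 : ψ (Ideal.Quotient.mk _ 1) = s := one_smul A _
    rwa [← hh1, ← h3, h2]
  have hK (k : A) (hk : f k = 0) : k * h 1 = 0 := by
    rw [← hh1, Ideal.Quotient.eq_zero_iff_mem.2 hk, map_zero]
  refine ⟨h 1, fun x => ⟨fun hx => ?_, hK x⟩⟩
  by_contra hfx
  obtain ⟨r', hr⟩ := exists_mul_eq_socle hms' hfx
  obtain ⟨r, rfl⟩ := hf r'
  have h5 : (σ - r * x) * h 1 = 0 := hK _ (by rw [map_sub, map_mul, hr, sub_self])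
  rw [sub_mul, hσ, mul_assoc, hx, mul_zero, sub_zero] at h5
  exact hs h5

end SelfInjective

section Quotient

variable {A : Type} [CommRing A] {K : Ideal A} {a : A}

lemma InjDimLE.quotient_of_annihilator (h : InjDimLE A A 1) (ha : ∀ x, x * a = 0 ↔ x ∈ K)
    (hK : ∀ c, (∀ k ∈ K, k * c = 0) → a ∣ c) : InjDimLE (A ⧸ K) (A ⧸ K) 1 := by
  obtain ⟨I, _, _, _, i, hi⟩ := exists_injective_embedding A A
  have hiπ := LinearMap.exact_map_mkQ_range i
  have hπ := Submodule.mkQ_surjective (LinearMap.range i)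
  have hC : Module.Injective A (I ⧸ LinearMap.range i) :=
    injDimLE_zero_iff.1 ((injDimLE_succ_iff hi hiπ hπ 0).1 h)
  have hmul (x : A) : i (x * a) = x • i a := by rw [← smul_eq_mul, map_smul]
  let φ : (A ⧸ K) →ₗ[A] I := K.liftQ (LinearMap.toSpanSingleton A I (i a)) fun k hk => by
    change k • i a = 0
    rw [← hmul, (ha k).2 hk, map_zero]
  have hφ (x : A) : φ (Ideal.Quotient.mk K x) = i (x * a) := (hmul x).symm
  have hinj : Function.Injective (toTorsion K φ) := by
    rw [injective_iff_map_eq_zero]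
    intro x hx
    obtain ⟨x, rfl⟩ := Ideal.Quotient.mk_surjective x
    have h1 : φ (Ideal.Quotient.mk K x) = 0 := congrArg Subtype.val hx
    rw [hφ] at h1
    exact Ideal.Quotient.eq_zero_iff_mem.2 ((ha x).1 (hi (h1.trans (map_zero i).symm)))
  have hex : Function.Exact (toTorsion K φ) (torsionMap K (LinearMap.range i).mkQ) := by
    intro w
    constructor
    · intro hw
      obtain ⟨c, hc⟩ := (hiπ w).1 (congrArg Subtype.val hw)
      obtain ⟨b, rfl⟩ := hK c fun k hk => hi (by
        rw [← smul_eq_mul, map_smul, hc, smul_coe_torsion K hk, map_zero])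
      refine ⟨Ideal.Quotient.mk K b, Subtype.ext ?_⟩
      rw [coe_toTorsion, hφ, mul_comm, hc]
    · rintro ⟨x, rfl⟩
      obtain ⟨x, rfl⟩ := Ideal.Quotient.mk_surjective x
      refine Subtype.ext ?_
      rw [coe_torsionMap, coe_toTorsion, hφ]
      exact hiπ.apply_apply_eq_zero _
  have hsurj : Function.Surjective (torsionMap K (LinearMap.range i).mkQ) := by
    intro z
    let α : (A ⧸ K) →ₗ[A] A := K.liftQ (LinearMap.toSpanSingleton A A a) fun k hk => (ha k).2 hk
    have hα : Function.Injective α := LinearMap.ker_eq_bot.1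
      (Submodule.ker_liftQ_eq_bot _ _ _ fun t ht => (ha t).1 ht)
    let β : (A ⧸ K) →ₗ[A] (I ⧸ LinearMap.range i) :=
      K.liftQ (LinearMap.toSpanSingleton A _ (z : I ⧸ LinearMap.range i))
        fun k hk => smul_coe_torsion K hk z
    obtain ⟨γ, hγ⟩ := Module.Injective.out α hα β
    obtain ⟨u, hu⟩ := hπ (γ 1)
    have h1 : γ (α (Ideal.Quotient.mk K 1)) = β (Ideal.Quotient.mk K 1) := hγ _
    have h2 : α (Ideal.Quotient.mk K 1) = a := one_smul A _
    have h3 : β (Ideal.Quotient.mk K 1) = z := one_smul A _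
    refine ⟨⟨a • u, (Submodule.mem_torsionBySet_iff _ _).2 fun k => ?_⟩, Subtype.ext ?_⟩
    · rw [← mul_smul, (ha k).2 k.2, zero_smul]
    · rw [coe_torsionMap, map_smul, hu, ← map_smul, smul_eq_mul, mul_one, ← h3, ← h1, h2]
  exact (injDimLE_succ_iff hinj hex hsurj 0).2 (injDimLE_zero_iff.2 inferInstance)

lemma InjDimLE.quotient_of_socle [IsNoetherianRing A] [IsLocalRing A] {n : ℕ} (h : InjDimLE A A n)
    (ha : ∀ x, x * a = 0 ↔ x ∈ K) (hK : ∀ c, (∀ k ∈ K, k * c = 0) → a ∣ c) {η z : A}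
    (hη : ∀ x, η * x ∈ K → x ∈ K) (hz : z ∉ K ⊔ Ideal.span {η})
    (hmz : ∀ t ∈ IsLocalRing.maximalIdeal A, t * z ∈ K ⊔ Ideal.span {η}) :
    InjDimLE (A ⧸ K) (A ⧸ K) 1 := by
  refine InjDimLE.quotient_of_annihilator ?_ ha hK
  by_cases hm : ∀ t ∈ IsLocalRing.maximalIdeal A, t ∉ nonZeroDivisors A
  · obtain ⟨s, hs, hms⟩ := exists_socle_of_forall_notMem hm
    exact (h.zero_of_socle hs hms).mono (by omega)
  push Not at hm
  obtain ⟨y, hym, hy⟩ := hm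
  have hmem (x : A) : x ∈ K ⊔ Ideal.span {η} ↔ ∃ b, x - η * b ∈ K := by
    rw [Submodule.mem_sup]
    constructor
    · rintro ⟨k, hk, w, hw, rfl⟩
      obtain ⟨b, rfl⟩ := Ideal.mem_span_singleton.1 hw
      exact ⟨b, by simpa using hk⟩
    · rintro ⟨b, hb⟩
      exact ⟨_, hb, η * b, Ideal.mem_span_singleton.2 ⟨b, rfl⟩, by ring⟩
  obtain ⟨b, hb⟩ := (hmem _).1 (hmz y hym)
  refine h.one_of_socle_quotient (b := a * b) hy (fun hab => hz ?_) fun t ht => ?_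
  · obtain ⟨c, hc⟩ := Ideal.mem_span_singleton.1 hab
    obtain ⟨c', rfl⟩ := hK c fun k hk => by
      refine (mul_cancel_left_mem_nonZeroDivisors hy).1 ?_
      linear_combination (-k) * hc + b * (ha k).2 hk
    refine (hmem z).2 ⟨c', (ha _).1 ((mul_cancel_left_mem_nonZeroDivisors hy).1 ?_)⟩
    linear_combination (ha _).2 hb + η * hc
  · obtain ⟨b', hb'⟩ := (hmem _).1 (hmz t ht)
    have h1 : t * b - y * b' ∈ K := hη _ (by
      have := K.sub_mem (K.mul_mem_left y hb') (K.mul_mem_left t hb)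
      convert! this using 1; ring)
    refine Ideal.mem_span_singleton.2 ⟨a * b', ?_⟩
    linear_combination (ha _).2 h1

end Quotient

lemma InjDimLE.of_surjective_of_socle {A R : Type} [CommRing A] [CommRing R] [IsNoetherianRing A]
    [IsLocalRing A] [IsLocalRing R] {n : ℕ} (h : InjDimLE A A n) (φ : A →+* R)
    (hφ : Function.Surjective φ) {a : A} (ha : ∀ x, x * a = 0 ↔ φ x = 0)
    (hK : ∀ c, (∀ k, φ k = 0 → k * c = 0) → a ∣ c) {η z : R} (hη : η ∈ nonZeroDivisors R)
    (hz : ¬ η ∣ z) (hmz : ∀ t ∈ IsLocalRing.maximalIdeal R, η ∣ t * z) : InjDimLE R R 1 := by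
  obtain ⟨η, rfl⟩ := hφ η
  obtain ⟨z, rfl⟩ := hφ z
  have hloc : IsLocalHom φ := .of_surjective φ hφ
  have hmem (x : A) : x ∈ RingHom.ker φ ⊔ Ideal.span {η} ↔ φ η ∣ φ x := by
    rw [Submodule.mem_sup]
    constructor
    · rintro ⟨k, hk, w, hw, rfl⟩
      obtain ⟨b, rfl⟩ := Ideal.mem_span_singleton.1 hw
      exact ⟨φ b, by rw [map_add, RingHom.mem_ker.1 hk, zero_add, map_mul]⟩
    · rintro ⟨b, hb⟩
      obtain ⟨b, rfl⟩ := hφ b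
      exact ⟨x - η * b, by rw [RingHom.mem_ker, map_sub, map_mul, hb, sub_self], η * b,
        Ideal.mem_span_singleton.2 ⟨b, rfl⟩, by ring⟩
  refine InjDimLE.of_ringEquiv (RingHom.quotientKerEquivOfSurjective hφ)
    (h.quotient_of_socle (K := RingHom.ker φ) ha hK (η := η) (z := z) (fun x hx => ?_) ?_
      fun t ht => ?_)
  · rw [RingHom.mem_ker, map_mul] at hx
    exact (mul_left_mem_nonZeroDivisors_eq_zero_iff hη).1 hx
  · rwa [hmem]
  · rw [hmem, map_mul]
    exact hmz _ fun hu => ht ((isUnit_map_iff φ t).1 hu)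

section Localization

variable {S : Type} [CommRing S] (q : Ideal S) [q.IsPrime]

lemma exists_eq_isUnit_mul (x : Localization.AtPrime q) :
    ∃ u x₀, IsUnit u ∧ x = u * algebraMap S (Localization.AtPrime q) x₀ := by
  obtain ⟨x₀, s, rfl⟩ := IsLocalization.exists_mk'_eq q.primeCompl x
  refine ⟨IsLocalization.mk' _ 1 s, x₀, ?_, ?_⟩
  · refine IsUnit.of_mul_eq_one (algebraMap S _ s) ?_
    rw [IsLocalization.mk'_spec, map_one]
  · rw [mul_comm, ← IsLocalization.mk'_eq_mul_mk'_one]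

variable {q}

lemma algebraMap_atPrime_eq_zero_iff {x : S} :
    algebraMap S (Localization.AtPrime q) x = 0 ↔ ∃ t ∉ q, t * x = 0 := by
  rw [IsLocalization.map_eq_zero_iff q.primeCompl]
  exact ⟨fun ⟨m, hm⟩ => ⟨m, m.2, hm⟩, fun ⟨t, ht, h⟩ => ⟨⟨t, ht⟩, h⟩⟩

lemma isUnit_algebraMap_atPrime {t : S} (ht : t ∉ q) :
    IsUnit (algebraMap S (Localization.AtPrime q) t) :=
  IsLocalization.map_units _ (⟨t, ht⟩ : q.primeCompl)

lemma algebraMap_atPrime_dvd_iff {h z : S} :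
    algebraMap S (Localization.AtPrime q) h ∣ algebraMap S (Localization.AtPrime q) z ↔
      ∃ t ∉ q, h ∣ t * z := by
  constructor
  · rintro ⟨c, hc⟩
    obtain ⟨⟨b, s⟩, hs⟩ := IsLocalization.surj q.primeCompl c
    have h1 : algebraMap S (Localization.AtPrime q) (s * z - h * b) = 0 := by
      rw [map_sub, map_mul, map_mul, hc, ← hs]; ring
    obtain ⟨t, ht, h2⟩ := algebraMap_atPrime_eq_zero_iff.1 h1
    exact ⟨t * s, q.primeCompl.mul_mem ht s.2, t * b, by linear_combination h2⟩
  · rintro ⟨t, ht, b, hb⟩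
    refine (isUnit_algebraMap_atPrime ht).dvd_mul_left.1 ?_
    rw [← map_mul, hb, map_mul]
    exact dvd_mul_right _ _

lemma exists_forall_mul_mem [IsNoetherianRing S] {I J : Ideal S}
    (h : ∀ i ∈ I, ∃ u ∉ q, u * i ∈ J) : ∃ t ∉ q, ∀ i ∈ I, t * i ∈ J := by
  obtain ⟨s, rfl⟩ := IsNoetherian.noetherian I
  choose! u hu huJ using h
  have hu' (i) (hi : i ∈ s) := hu i (Submodule.subset_span hi)
  refine ⟨∏ i ∈ s, u i, ?_, fun i hi => ?_⟩
  · exact q.primeCompl.prod_mem hu'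
  · induction hi using Submodule.span_induction with
    | mem x hx =>
      obtain ⟨c, hc⟩ := Finset.dvd_prod_of_mem u hx
      rw [hc, mul_comm (u x), mul_assoc]
      exact J.mul_mem_left c (huJ x (Submodule.subset_span hx))
    | zero => simp
    | add x y _ _ hx hy => rw [mul_add]; exact J.add_mem hx hy
    | smul a x _ hx => rw [smul_eq_mul, mul_left_comm]; exact J.mul_mem_left a hx

variable {R : Type} [CommRing R] {p : Ideal R} [p.IsPrime] {f : S →+* R}

lemma localRingHom_surjective (hf : Function.Surjective f) (hq : q = p.comap f) :
    Function.Surjective (Localization.localRingHom q p f hq) := by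
  intro x
  obtain ⟨r, ⟨s, hs⟩, rfl⟩ := IsLocalization.exists_mk'_eq p.primeCompl x
  obtain ⟨r, rfl⟩ := hf r
  obtain ⟨s, rfl⟩ := hf s
  exact ⟨IsLocalization.mk' _ r (⟨s, hq ▸ hs⟩ : q.primeCompl), Localization.localRingHom_mk' ..⟩

lemma localRingHom_algebraMap_eq_zero_iff (hf : Function.Surjective f) (hq : q = p.comap f)
    {x : S} : Localization.localRingHom q p f hq (algebraMap S _ x) = 0 ↔
      ∃ t ∉ q, f (t * x) = 0 := by
  rw [Localization.localRingHom_to_map, algebraMap_atPrime_eq_zero_iff]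
  constructor
  · rintro ⟨t, ht, h⟩
    obtain ⟨t, rfl⟩ := hf t
    exact ⟨t, hq ▸ ht, by rwa [map_mul]⟩
  · rintro ⟨t, ht, h⟩
    exact ⟨f t, fun h' => ht (hq ▸ h'), by rwa [← map_mul]⟩

lemma ker_localRingHom_of_ker_eq_span (hf : Function.Surjective f) (hq : q = p.comap f) {y : S}
    (hy : RingHom.ker f = Ideal.span {y}) :
    RingHom.ker (Localization.localRingHom q p f hq) =
      Ideal.span {algebraMap S (Localization.AtPrime q) y} := by
  ext x
  obtain ⟨u, x, hu, rfl⟩ := exists_eq_isUnit_mul q x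
  rw [RingHom.mem_ker, map_mul, (hu.map _).mul_right_eq_zero,
    localRingHom_algebraMap_eq_zero_iff hf hq, Ideal.mem_span_singleton, hu.dvd_mul_left,
    algebraMap_atPrime_dvd_iff]
  simp_rw [← RingHom.mem_ker, hy, Ideal.mem_span_singleton]

/-- Self-injective dimension at a prime drops when dividing by a local nonzerodivisor. -/
lemma InjDimLE.of_ker_eq_span (hf : Function.Surjective f) (hq : q = p.comap f) {y : S}
    (hy : RingHom.ker f = Ideal.span {y})
    (hy' : algebraMap S (Localization.AtPrime q) y ∈ nonZeroDivisors _) {n : ℕ}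
    (h : InjDimLE (Localization.AtPrime q) (Localization.AtPrime q) (n + 1)) :
    InjDimLE (Localization.AtPrime p) (Localization.AtPrime p) n :=
  (h.quotient hy').of_ringEquiv
    ((Ideal.quotEquivOfEq (ker_localRingHom_of_ker_eq_span hf hq hy).symm).trans
      (RingHom.quotientKerEquivOfSurjective (localRingHom_surjective hf hq)))

end Localization

/-- Let `Q_P` be a quotient of a ring of finite self-injective dimension by the annihilator of an
element `a` generating the annihilator of the kernel. If `P` is the annihilator of an element
modulo a nonzerodivisor of `Q`, then `Q_P` has self-injective dimension at most one. -/
lemma injDimLE_one_of_colon {S Q : Type} [CommRing S] [CommRing Q] [IsNoetherianRing S]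
    {f : S →+* Q} (hf : Function.Surjective f) {P : Ideal Q} [P.IsPrime] {n : ℕ}
    (hn : InjDimLE (Localization.AtPrime (P.comap f)) (Localization.AtPrime (P.comap f)) n)
    {a : Localization.AtPrime (P.comap f)}
    (ha : ∀ x, x * a = 0 ↔ Localization.localRingHom (P.comap f) P f rfl x = 0)
    (hK : ∀ c, (∀ k, Localization.localRingHom (P.comap f) P f rfl k = 0 → k * c = 0) → a ∣ c)
    {h z : Q} (hh : h ∈ nonZeroDivisors Q) (hP : ∀ t, t ∈ P ↔ h ∣ t * z) :
    InjDimLE (Localization.AtPrime P) (Localization.AtPrime P) 1 := by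
  refine hn.of_surjective_of_socle (Localization.localRingHom (P.comap f) P f rfl)
    (localRingHom_surjective hf rfl) ha hK (η := algebraMap Q _ h) (z := algebraMap Q _ z)
    ?_ ?_ ?_
  · exact IsLocalization.map_nonZeroDivisors_le P.primeCompl _ ⟨h, hh, rfl⟩
  · rw [algebraMap_atPrime_dvd_iff]
    rintro ⟨t, ht, h1⟩
    exact ht ((hP t).2 h1)
  · intro t ht
    obtain ⟨v, t, hv, rfl⟩ := exists_eq_isUnit_mul P t
    have ht' : algebraMap Q (Localization.AtPrime P) t ∈ IsLocalRing.maximalIdeal _ := by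
      have := Ideal.mul_mem_left _ (↑hv.unit⁻¹ : Localization.AtPrime P) ht
      rwa [← mul_assoc, hv.val_inv_mul, one_mul] at this
    rw [IsLocalization.AtPrime.to_map_mem_maximal_iff _ P] at ht'
    rw [mul_assoc, ← map_mul]
    exact (map_dvd _ ((hP t).1 ht')).mul_left _

section Generic

variable {S Q : Type} [CommRing S] [CommRing Q] [IsNoetherianRing S] [IsNoetherianRing Q]
  {f : S →+* Q} {p : Ideal Q} [p.IsPrime]

/-- The presentation of `Q_p` as a quotient of the self-injective ring `S_q` by the annihilator of
an element spreads out to a neighbourhood of `p`. -/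
lemma exists_generator_annihilator_nhds (hf : Function.Surjective f)
    [Module.Injective (Localization.AtPrime p) (Localization.AtPrime p)]
    [Module.Injective (Localization.AtPrime (p.comap f)) (Localization.AtPrime (p.comap f))] :
    ∃ t ∉ p.comap f, ∀ (P : Ideal Q) [P.IsPrime], t ∉ P.comap f →
      ∃ a : Localization.AtPrime (P.comap f),
        (∀ x, x * a = 0 ↔ Localization.localRingHom (P.comap f) P f rfl x = 0) ∧
        ∀ c, (∀ k, Localization.localRingHom (P.comap f) P f rfl k = 0 → k * c = 0) → a ∣ c := by
  let q := p.comap f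
  obtain ⟨a, ha, hK⟩ := exists_generator_annihilator
    (Localization.localRingHom q p f rfl) (localRingHom_surjective hf rfl)
  obtain ⟨u, α, hu, rfl⟩ := exists_eq_isUnit_mul q a
  have hα (x : S) : algebraMap S (Localization.AtPrime q) (x * α) = 0 ↔ ∃ t ∉ q, f (t * x) = 0 := by
    rw [← localRingHom_algebraMap_eq_zero_iff hf rfl, ← ha, mul_left_comm, hu.mul_right_eq_zero,
      map_mul]
  let K := RingHom.ker f
  let annα : Ideal S := LinearMap.ker (LinearMap.mulRight S α)
  have hannα (x : S) : x ∈ annα ↔ x * α = 0 := Iff.rfl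
  obtain ⟨t₁, ht₁, hK₁⟩ : ∃ t ∉ q, ∀ k ∈ K, t * k ∈ annα := exists_forall_mul_mem fun k hk => by
    obtain ⟨t, ht, h⟩ := algebraMap_atPrime_eq_zero_iff.1 ((hα k).2
      ⟨1, q.one_notMem, by rwa [one_mul]⟩)
    exact ⟨t, ht, by rwa [hannα, mul_assoc]⟩
  obtain ⟨t₂, ht₂, hK₂⟩ : ∃ t ∉ q, ∀ x ∈ annα, t * x ∈ K := exists_forall_mul_mem fun x hx =>
    (hα x).1 (by rw [(hannα x).1 hx, map_zero])
  obtain ⟨t₃, ht₃, hK₃⟩ : ∃ t ∉ q, ∀ c ∈ Submodule.annihilator K, t * c ∈ Ideal.span {α} :=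
    exists_forall_mul_mem fun c hc => by
      simp_rw [Ideal.mem_span_singleton, ← algebraMap_atPrime_dvd_iff]
      refine (dvd_mul_left _ _).trans (hK _ fun x hx => ?_)
      obtain ⟨v, x, hv, rfl⟩ := exists_eq_isUnit_mul q x
      rw [map_mul, (hv.map _).mul_right_eq_zero, localRingHom_algebraMap_eq_zero_iff hf rfl] at hx
      obtain ⟨t, ht, h⟩ := hx
      rw [mul_assoc, hv.mul_right_eq_zero, ← map_mul, algebraMap_atPrime_eq_zero_iff]
      refine ⟨t, ht, ?_⟩
      rw [← mul_assoc, mul_comm]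
      exact Submodule.mem_annihilator.1 hc _ h
  refine ⟨t₁ * t₂ * t₃, q.primeCompl.mul_mem (q.primeCompl.mul_mem ht₁ ht₂) ht₃,
    fun P _ htP => ?_⟩
  let P₀ := P.comap f
  have htP₁ : t₁ ∉ P₀ := fun h => htP (P₀.mul_mem_right _ (P₀.mul_mem_right _ h))
  have htP₂ : t₂ ∉ P₀ := fun h => htP (P₀.mul_mem_right _ (P₀.mul_mem_left _ h))
  have htP₃ : t₃ ∉ P₀ := fun h => htP (P₀.mul_mem_left _ h)
  refine ⟨algebraMap S _ α, fun x => ?_, fun c hc => ?_⟩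
  · obtain ⟨v, x, hv, rfl⟩ := exists_eq_isUnit_mul P₀ x
    rw [map_mul, (hv.map _).mul_right_eq_zero, localRingHom_algebraMap_eq_zero_iff hf rfl,
      mul_assoc, hv.mul_right_eq_zero, ← map_mul, algebraMap_atPrime_eq_zero_iff]
    constructor
    · rintro ⟨t, ht, h⟩
      refine ⟨t₂ * t, P₀.primeCompl.mul_mem htP₂ ht, ?_⟩
      rw [mul_assoc]
      exact hK₂ _ (by rwa [hannα, mul_assoc])
    · rintro ⟨t, ht, h⟩
      refine ⟨t₁ * t, P₀.primeCompl.mul_mem htP₁ ht, ?_⟩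
      rw [← mul_assoc, mul_assoc t₁]
      exact hK₁ _ h
  · obtain ⟨v, c, hv, rfl⟩ := exists_eq_isUnit_mul P₀ c
    rw [hv.dvd_mul_left, algebraMap_atPrime_dvd_iff]
    let J : Ideal S := LinearMap.ker (LinearMap.mulRight S c)
    obtain ⟨t, ht, hJ⟩ : ∃ t ∉ P₀, ∀ k ∈ K, t * k ∈ J := exists_forall_mul_mem fun k hk => by
      have h1 := hc (algebraMap S _ k) ((localRingHom_algebraMap_eq_zero_iff hf rfl).2
        ⟨1, P₀.one_notMem, by rwa [one_mul]⟩)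
      rw [mul_left_comm, hv.mul_right_eq_zero, ← map_mul, algebraMap_atPrime_eq_zero_iff] at h1
      obtain ⟨t, ht, h⟩ := h1
      exact ⟨t, ht, by rw [← mul_assoc] at h; exact h⟩
    refine ⟨t₃ * t, P₀.primeCompl.mul_mem htP₃ ht, ?_⟩
    rw [mul_assoc]
    refine Ideal.mem_span_singleton.1 (hK₃ _ (Submodule.mem_annihilator.2 fun k hk => ?_))
    have h2 : t * k * c = 0 := hJ k hk
    rw [smul_eq_mul]
    linear_combination h2

/-- If the kernel of `S_q → Q_p` consists of zerodivisors, `Q_p` is self-injective and `S_q` has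
finite self-injective dimension, then `S_q` is self-injective. -/
lemma injective_of_forall_ker_notMem_nonZeroDivisors (hf : Function.Surjective f)
    [Module.Injective (Localization.AtPrime p) (Localization.AtPrime p)] {n : ℕ}
    (hn : InjDimLE (Localization.AtPrime (p.comap f)) (Localization.AtPrime (p.comap f)) n)
    (h : ∀ y, f y = 0 → algebraMap S (Localization.AtPrime (p.comap f)) y ∉ nonZeroDivisors _) :
    Module.Injective (Localization.AtPrime (p.comap f)) (Localization.AtPrime (p.comap f)) := by
  let q := p.comap f
  let φ := Localization.localRingHom q p f rfl
  have hφ : IsLocalHom φ := Localization.isLocalHom_localRingHom q p f rfl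
  have hker : ∀ t ∈ RingHom.ker φ, t ∉ nonZeroDivisors (Localization.AtPrime q) := by
    intro t ht htn
    obtain ⟨v, t, hv, rfl⟩ := exists_eq_isUnit_mul q t
    rw [RingHom.mem_ker, map_mul, (hv.map φ).mul_right_eq_zero,
      localRingHom_algebraMap_eq_zero_iff hf rfl] at ht
    obtain ⟨u, hu, hut⟩ := ht
    refine h _ hut ?_
    rw [map_mul]
    refine mul_mem (isUnit_algebraMap_atPrime hu).mem_nonZeroDivisors ?_
    exact (mul_mem_nonZeroDivisors.1 htn).2
  obtain ⟨P, hP, hle⟩ := exists_mem_associatedPrimes_of_forall_notMem hker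
  obtain ⟨N, hN⟩ := exists_maximalIdeal_pow_eq_bot (A := Localization.AtPrime p)
  have hPm : IsLocalRing.maximalIdeal (Localization.AtPrime q) ≤ P := by
    refine hP.isPrime.le_of_pow_le (n := N) (le_trans ?_ hle)
    rw [RingHom.ker_eq_comap_bot, ← Ideal.map_le_iff_le_comap, Ideal.map_pow, ← hN]
    refine Ideal.pow_right_mono (Ideal.map_le_iff_le_comap.2 fun t ht => ?_) N
    exact fun hu => ht ((isUnit_map_iff φ t).1 hu)
  obtain ⟨hP, s, hs⟩ := mem_associatedPrimes_self_iff.1 hP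
  refine injDimLE_zero_iff.1 (hn.zero_of_socle (s := s) (fun h0 => hP.ne_top
    ((Ideal.eq_top_iff_one P).2 ((hs 1).2 (by simp [h0])))) fun t ht => (hs t).1 (hPm ht))

/-- If `Q` is a quotient of a ring whose localizations near `p` have finite self-injective
dimension and `Q_p` is self-injective, then near `p` the self-injective dimension of `Q` is at
most one at all primes associated to a nonzerodivisor. -/
lemma exists_injDimLE_one_nhds (n : ℕ) {S : Type} [CommRing S] [IsNoetherianRing S] {f : S →+* Q}
    (hf : Function.Surjective f)
    [hp : Module.Injective (Localization.AtPrime p) (Localization.AtPrime p)]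
    {x : Q} (hx : x ∉ p)
    (hS : ∀ (P : Ideal Q) [P.IsPrime], x ∉ P → ∃ m,
      InjDimLE (Localization.AtPrime (P.comap f)) (Localization.AtPrime (P.comap f)) m)
    (hn : InjDimLE (Localization.AtPrime (p.comap f)) (Localization.AtPrime (p.comap f)) n) :
    ∃ x' ∉ p, ∀ (P : Ideal Q) [P.IsPrime], x' ∉ P → ∀ h ∈ nonZeroDivisors Q, ∀ z : Q,
      (∀ t, t ∈ P ↔ h ∣ t * z) →
      InjDimLE (Localization.AtPrime P) (Localization.AtPrime P) 1 := by
  induction n generalizing S x with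
  | zero =>
    have := injDimLE_zero_iff.1 hn
    obtain ⟨t, ht, H⟩ := exists_generator_annihilator_nhds (p := p) hf
    refine ⟨x * f t, p.primeCompl.mul_mem hx ht, fun P _ hxP h hh z hz => ?_⟩
    obtain ⟨m, hm⟩ := hS P fun h' => hxP (P.mul_mem_right _ h')
    obtain ⟨a, ha, hK⟩ := H P fun h' => hxP (P.mul_mem_left _ h')
    exact injDimLE_one_of_colon hf hm ha hK hh hz
  | succ n ih =>
    by_cases hy : ∃ y, f y = 0 ∧
      algebraMap S (Localization.AtPrime (p.comap f)) y ∈ nonZeroDivisors _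
    · obtain ⟨y, hfy, hy⟩ := hy
      let J : Ideal S := LinearMap.ker (LinearMap.mulRight S y)
      obtain ⟨t, ht, hJ⟩ : ∃ t ∉ p.comap f, ∀ k ∈ J, t * k ∈ (⊥ : Ideal S) :=
        exists_forall_mul_mem fun k hk => algebraMap_atPrime_eq_zero_iff.1
          ((mul_right_mem_nonZeroDivisors_eq_zero_iff hy).1 (by
            rw [← map_mul, show k * y = 0 from hk, map_zero]))
      have hreg (P₀ : Ideal S) [P₀.IsPrime] (htP : t ∉ P₀) :
          algebraMap S (Localization.AtPrime P₀) y ∈ nonZeroDivisors _ := by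
        rw [mem_nonZeroDivisors_iff_right]
        intro c hc
        obtain ⟨v, c, hv, rfl⟩ := exists_eq_isUnit_mul P₀ c
        rw [mul_assoc, hv.mul_right_eq_zero, ← map_mul, algebraMap_atPrime_eq_zero_iff] at hc
        obtain ⟨u, hu, h⟩ := hc
        rw [hv.mul_right_eq_zero, algebraMap_atPrime_eq_zero_iff]
        refine ⟨t * u, P₀.primeCompl.mul_mem htP hu, ?_⟩
        rw [mul_assoc]
        exact hJ _ (by rw [← mul_assoc] at h; exact h)
      let π := Ideal.Quotient.mk (Ideal.span {y})
      have hπ : Function.Surjective π := Ideal.Quotient.mk_surjective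
      have hkerπ : RingHom.ker π = Ideal.span {y} := Ideal.mk_ker
      let f' : S ⧸ Ideal.span {y} →+* Q := Ideal.Quotient.lift _ f fun a ha => by
        obtain ⟨b, rfl⟩ := Ideal.mem_span_singleton.1 ha
        rw [map_mul, hfy, zero_mul]
      have hf' : Function.Surjective f' := Ideal.Quotient.lift_surjective_of_surjective _ _ hf
      have hcomap (P : Ideal Q) : P.comap f = (P.comap f').comap π := rfl
      refine ih hf' (x := x * f t) (p.primeCompl.mul_mem hx ht) (fun P _ hxP => ?_) ?_
      · obtain ⟨m, hm⟩ := hS P fun h' => hxP (P.mul_mem_right _ h')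
        exact ⟨m, (hm.mono (Nat.le_succ m)).of_ker_eq_span hπ (hcomap P) hkerπ
          (hreg _ fun h' => hxP (P.mul_mem_left _ h'))⟩
      · exact hn.of_ker_eq_span hπ (hcomap p) hkerπ hy
    · push Not at hy
      have := injective_of_forall_ker_notMem_nonZeroDivisors hf hn hy
      obtain ⟨t, ht, H⟩ := exists_generator_annihilator_nhds (p := p) hf
      refine ⟨x * f t, p.primeCompl.mul_mem hx ht, fun P _ hxP h hh z hz => ?_⟩
      obtain ⟨m, hm⟩ := hS P fun h' => hxP (P.mul_mem_right _ h')
      obtain ⟨a, ha, hK⟩ := H P fun h' => hxP (P.mul_mem_left _ h')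
      exact injDimLE_one_of_colon hf hm ha hK hh hz

end Generic

/-- A prime associated to `(h)` that contains another nonzerodivisor `x` is associated to `(x)`. -/
lemma exists_mem_iff_dvd_mul {Q : Type} [CommRing Q] {P : Ideal Q} {h x z : Q} (hh : h ∈ nonZeroDivisors Q)
    (hx : x ∈ nonZeroDivisors Q) (hz : ∀ t, t ∈ P ↔ h ∣ t * z) (hxP : x ∈ P) :
    ∃ b, ∀ t, t ∈ P ↔ x ∣ t * b := by
  obtain ⟨b, hb⟩ := (hz x).1 hxP
  refine ⟨b, fun t => (hz t).trans ⟨?_, ?_⟩⟩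
  · rintro ⟨c, hc⟩
    refine ⟨c, (mul_cancel_left_mem_nonZeroDivisors hh).1 ?_⟩
    linear_combination x * hc - t * hb
  · rintro ⟨c, hc⟩
    refine ⟨c, (mul_cancel_left_mem_nonZeroDivisors hx).1 ?_⟩
    linear_combination h * hc + t * hb

section GenericallyGorenstein

variable {Q : Type} [CommRing Q] [IsNoetherianRing Q]

/-- A localization at an associated prime which is Gorenstein is self-injective. -/
lemma injective_localization_of_mem_associatedPrimes (hgen : IsGenericallyGorenstein Q)
    {p : Ideal Q} [hp : p.IsPrime] (hpA : p ∈ associatedPrimes Q Q) :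
    Module.Injective (Localization.AtPrime p) (Localization.AtPrime p) := by
  obtain ⟨n, hn⟩ := hasFiniteSelfInjDim_iff.1 (hgen p hp hpA).2.2
  obtain ⟨-, x, hx⟩ := mem_associatedPrimes_self_iff.1 hpA
  have : IsNoetherianRing (Localization.AtPrime p) := (hgen p hp hpA).1
  refine injDimLE_zero_iff.1 (InjDimLE.zero_of_socle (s := algebraMap Q _ x) hn ?_ fun t ht => ?_)
  · rw [Ne, algebraMap_atPrime_eq_zero_iff]
    rintro ⟨t, ht, h⟩
    exact ht ((hx t).2 h)
  · obtain ⟨u, t, hu, rfl⟩ := exists_eq_isUnit_mul p t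
    have ht' : t ∈ p := by
      rw [Ideal.unit_mul_mem_iff_mem _ hu] at ht
      exact (IsLocalization.AtPrime.to_map_mem_maximal_iff _ p t).1 ht
    rw [mul_assoc, ← map_mul, (hx t).1 ht', map_zero, mul_zero]

/-- For a generically Gorenstein homomorphic image `Q` of a Gorenstein local ring there is a
nonzerodivisor `x` such that `Q` is Gorenstein at every prime that avoids `x` and is associated
to a principal ideal generated by a nonzerodivisor. -/
lemma exists_nonZeroDivisor_injDimLE_one (hgen : IsGenericallyGorenstein Q)
    (himg : ∃ (G : Type) (_ : CommRing G), IsGorensteinLocalRing G ∧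
      ∃ f : G →+* Q, Function.Surjective f) :
    ∃ x ∈ nonZeroDivisors Q, ∀ (P : Ideal Q) [P.IsPrime], x ∉ P →
      ∀ h ∈ nonZeroDivisors Q, ∀ z : Q, (∀ t, t ∈ P ↔ h ∣ t * z) →
      InjDimLE (Localization.AtPrime P) (Localization.AtPrime P) 1 := by
  obtain ⟨G, _, ⟨_, _, hG⟩, f, hf⟩ := himg
  obtain ⟨n, hn⟩ := hasFiniteSelfInjDim_iff.1 hG
  let good (x : Q) : Prop := ∀ (P : Ideal Q) [P.IsPrime], x ∉ P →
      ∀ h ∈ nonZeroDivisors Q, ∀ z : Q, (∀ t, t ∈ P ↔ h ∣ t * z) →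
      InjDimLE (Localization.AtPrime P) (Localization.AtPrime P) 1
  have key (p : Ideal Q) (hp : p ∈ associatedPrimes Q Q) : ∃ x ∉ p, good x := by
    have := (mem_associatedPrimes_self_iff.1 hp).1
    have := injective_localization_of_mem_associatedPrimes hgen hp
    exact exists_injDimLE_one_nhds (p := p) n hf (x := 1)
      (fun h => Ideal.IsPrime.ne_top ‹_› ((Ideal.eq_top_iff_one p).2 h))
      (fun P _ _ => ⟨n, InjDimLE.localization _ hn⟩) (InjDimLE.localization _ hn)
  by_contra! H
  obtain ⟨p, hp, hle⟩ := exists_mem_associatedPrimes_of_forall_notMem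
    (I := Ideal.span {x | good x}) fun x hx hxn => by
      obtain ⟨P, _, hxP, h, hh, z, hz, hP⟩ := H x hxn
      refine hxP ((Ideal.span_le (I := P)).2 (fun y hy => ?_) hx)
      by_contra hyP
      exact hP (hy P hyP h hh z hz)
  obtain ⟨x, hxp, hx⟩ := key p hp
  exact hxp (hle (Ideal.subset_span hx))

/-- If `h` is a nonzerodivisor avoiding all primes associated to `(x)`, with `x` as in
`exists_nonZeroDivisor_injDimLE_one`, then `Q / (h)` is generically Gorenstein. -/
lemma isGenericallyGorenstein_quotient {x h : Q} (hx : x ∈ nonZeroDivisors Q)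
    (hh : h ∈ nonZeroDivisors Q)
    (hgood : ∀ (P : Ideal Q) [P.IsPrime], x ∉ P →
      ∀ h ∈ nonZeroDivisors Q, ∀ z : Q, (∀ t, t ∈ P ↔ h ∣ t * z) →
      InjDimLE (Localization.AtPrime P) (Localization.AtPrime P) 1)
    (havoid : ∀ (P : Ideal Q) [P.IsPrime] (b : Q), (∀ t, t ∈ P ↔ x ∣ t * b) → h ∉ P) :
    IsGenericallyGorenstein (Q ⧸ Ideal.span {h}) := by
  intro p hp hpA
  obtain ⟨-, z, hz⟩ := mem_associatedPrimes_self_iff.1 hpA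
  obtain ⟨z, rfl⟩ := Ideal.Quotient.mk_surjective z
  let P := p.comap (Ideal.Quotient.mk (Ideal.span {h}))
  have hP (t : Q) : t ∈ P ↔ h ∣ t * z := by
    rw [Ideal.mem_comap, hz, ← map_mul, Ideal.Quotient.eq_zero_iff_dvd]
  have hhP : h ∈ P := (hP h).2 (dvd_mul_right _ _)
  have hxP : x ∉ P := fun hxP => by
    obtain ⟨b, hb⟩ := exists_mem_iff_dvd_mul hh hx hP hxP
    exact havoid P b hb hhP
  refine ⟨inferInstance, inferInstance, hasFiniteSelfInjDim_iff.2 ⟨0, ?_⟩⟩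
  exact InjDimLE.of_ker_eq_span (q := P) Ideal.Quotient.mk_surjective rfl Ideal.mk_ker
    (IsLocalization.map_nonZeroDivisors_le P.primeCompl _ (Submonoid.mem_map_of_mem _ hh)) (hgood P hxP h hh z hP)

end GenericallyGorenstein

/-- Prime avoidance for cosets: if no prime of a finite family contains both `a` and `J`, then
some element of `a + J` avoids the whole family. -/
lemma exists_add_notMem_of_finite {A : Type} [CommRing A] {s : Set (Ideal A)} (hs : s.Finite)
    (hprime : ∀ P ∈ s, P.IsPrime) {a : A} {J : Ideal A} (haJ : ∀ P ∈ s, a ∈ P → ¬ J ≤ P) :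
    ∃ y ∈ J, ∀ P ∈ s, a + y ∉ P := by
  classical
  lift s to Finset (Ideal A) using hs
  induction s using Finset.strongInduction with
  | H s ih =>
    obtain rfl | hne := s.eq_empty_or_nonempty
    · exact ⟨0, J.zero_mem, by simp⟩
    obtain ⟨P, hP⟩ := s.exists_minimal hne
    obtain ⟨y, hyJ, hy⟩ := ih (s.erase P) (Finset.erase_ssubset hP.prop)
      (fun P' h => hprime P' (Finset.mem_of_mem_erase h))
      (fun P' h => haJ P' (Finset.mem_of_mem_erase h))
    have := hprime P hP.prop
    by_cases hayP : a + y ∈ P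
    · have hJP : ¬ J ≤ P := fun hle => haJ P hP.prop ((P.add_mem_iff_left (hle hyJ)).1 hayP) hle
      have hprod : ¬ (∏ P' ∈ s.erase P, P') * J ≤ P := by
        rw [this.mul_le, this.prod_le]
        rintro (⟨P', hP', hle⟩ | hle)
        · exact Finset.ne_of_mem_erase hP'
            (hle.antisymm (hP.le_of_le (Finset.mem_of_mem_erase hP') hle))
        · exact hJP hle
      obtain ⟨c, hc, hcP⟩ := SetLike.not_le_iff_exists.1 hprod
      have hcs : c ∈ ∏ P' ∈ s.erase P, P' := Ideal.mul_le_left hc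
      have hcJ : c ∈ J := Ideal.mul_le_right hc
      refine ⟨y + c, J.add_mem hyJ hcJ, fun P' hP' => ?_⟩
      rw [← add_assoc]
      by_cases h : P' = P
      · subst h
        rwa [P'.add_mem_iff_right hayP]
      · have hP' : P' ∈ s.erase P := Finset.mem_erase.2 ⟨h, hP'⟩
        rw [P'.add_mem_iff_left
          ((Ideal.prod_le_inf.trans (Finset.inf_le hP')) hcs)]
        exact hy P' hP'
    · refine ⟨y, hyJ, fun P' hP' => ?_⟩
      by_cases h : P' = P
      · rwa [h]
      · exact hy P' (Finset.mem_coe.2 (Finset.mem_erase.2 ⟨h, hP'⟩))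

section RegularSequence

open RingTheory.Sequence

variable {Q : Type} [CommRing Q]

lemma isSMulRegular_self_iff {r : Q} : IsSMulRegular Q r ↔ r ∈ nonZeroDivisors Q := by
  rw [← isRegular_iff_mem_nonZeroDivisors, ← isLeftRegular_iff_isRegular]
  rfl

open scoped Pointwise in
lemma isWeaklyRegular_cons_iff_quotient {r : Q} {rs : List Q} :
    IsWeaklyRegular Q (r :: rs) ↔ r ∈ nonZeroDivisors Q ∧
      IsWeaklyRegular (Q ⧸ Ideal.span {r}) (rs.map (Ideal.Quotient.mk (Ideal.span {r}))) := by
  have h : r • (⊤ : Submodule Q Q) = Ideal.span {r} := by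
    rw [← Submodule.ideal_span_singleton_smul]; simp
  rw [isWeaklyRegular_cons_iff,
    (Submodule.quotEquivOfEq _ _ h).isWeaklyRegular_congr,
    ← isWeaklyRegular_map_algebraMap_iff (Q ⧸ Ideal.span {r}), Ideal.Quotient.algebraMap_eq,
    isSMulRegular_self_iff]

lemma RingTheory.Sequence.IsWeaklyRegular.dvd_of_dvd_mul {a b c : Q} {rs : List Q}
    (h : IsWeaklyRegular Q (a :: b :: rs)) (hc : a ∣ b * c) : a ∣ c := by
  obtain ⟨-, h⟩ := isWeaklyRegular_cons_iff_quotient.1 h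
  have hb := ((isWeaklyRegular_cons_iff _ _ _).1 h).1
  rw [← Ideal.Quotient.eq_zero_iff_dvd] at hc ⊢
  exact hb.right_eq_zero_of_smul (by rw [smul_eq_mul, ← map_mul, hc])

/-- Adding a combination of the remaining terms to the first term of a regular sequence in a
noetherian local ring gives a regular sequence. -/
lemma RingTheory.Sequence.IsWeaklyRegular.add_of_mem [IsNoetherianRing Q] [IsLocalRing Q] {a y : Q} {rs : List Q}
    (h : IsWeaklyRegular Q (a :: rs)) (hm : ∀ r ∈ a :: rs, r ∈ IsLocalRing.maximalIdeal Q)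
    (hy : y ∈ Ideal.ofList rs) : IsWeaklyRegular Q ((a + y) :: rs) := by
  have hyM : y ∈ IsLocalRing.maximalIdeal Q :=
    Ideal.span_le.2 (fun r hr => hm r (List.mem_cons_of_mem _ hr)) hy
  have h' := IsLocalRing.isWeaklyRegular_of_perm_of_subset_maximalIdeal h
    (List.perm_append_singleton a rs).symm hm
  rw [isWeaklyRegular_append_iff, isWeaklyRegular_singleton_iff] at h'
  refine IsLocalRing.isWeaklyRegular_of_perm_of_subset_maximalIdeal (rs := rs ++ [a + y]) ?_
    (List.perm_append_singleton _ rs) fun r hr => ?_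
  · rw [isWeaklyRegular_append_iff, isWeaklyRegular_singleton_iff]
    refine ⟨h'.1, fun u v huv => h'.2 ?_⟩
    have hzero (u : Q ⧸ (Ideal.ofList rs • ⊤ : Submodule Q Q)) : y • u = 0 := by
      obtain ⟨u, rfl⟩ := Submodule.Quotient.mk_surjective _ u
      rw [← Submodule.Quotient.mk_smul, Submodule.Quotient.mk_eq_zero]
      exact Submodule.smul_mem_smul hy trivial
    simpa [add_smul, hzero] using huv
  · obtain hr | hr := List.mem_append.1 hr
    · exact hm r (List.mem_cons_of_mem _ hr)
    · rw [List.mem_singleton.1 hr]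
      exact Ideal.add_mem _ (hm a List.mem_cons_self) hyM

end RegularSequence

section Depth

variable {Q : Type} [CommRing Q] [IsLocalRing Q]

lemma ringDepth_eq : ringDepth Q = sInf {n : ℕ∞ | ∃ i : ℕ, n = i ∧
    ¬ ExtVanish Q (Q ⧸ IsLocalRing.maximalIdeal Q) Q i} := by
  simp only [ringDepth, isZero_Ext_iff_subsingleton, ExtVanish]

/-- Dividing by a nonzerodivisor in the maximal ideal lowers the depth by one. -/
lemma ringDepth_quotient_add_one {h : Q} (hh : h ∈ nonZeroDivisors Q)
    (hm : h ∈ IsLocalRing.maximalIdeal Q) [IsLocalRing (Q ⧸ Ideal.span {h})] :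
    ringDepth (Q ⧸ Ideal.span {h}) + 1 = ringDepth Q := by
  let R := Q ⧸ Ideal.span {h}
  let k := R ⧸ IsLocalRing.maximalIdeal R
  have hcomap : (IsLocalRing.maximalIdeal R).comap (Ideal.Quotient.mk (Ideal.span {h})) =
      IsLocalRing.maximalIdeal Q := IsLocalRing.eq_maximalIdeal
    (Ideal.comap_isMaximal_of_surjective _ Ideal.Quotient.mk_surjective)
  let π : Q →ₗ[Q] k := Algebra.linearMap Q k
  have hker : LinearMap.ker π = IsLocalRing.maximalIdeal Q := by
    rw [← hcomap]
    ext a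
    exact Ideal.Quotient.eq_zero_iff_mem
  have hπ : Function.Surjective π :=
    Ideal.Quotient.mk_surjective.comp Ideal.Quotient.mk_surjective
  let e : (Q ⧸ IsLocalRing.maximalIdeal Q) ≃ₗ[Q] k :=
    (Submodule.quotEquivOfEq _ _ hker.symm).trans (π.quotKerEquivOfSurjective hπ)
  have hsucc (i : ℕ) : ExtVanish Q (Q ⧸ IsLocalRing.maximalIdeal Q) Q (i + 1) ↔
      ExtVanish R k R i := by
    rw [extVanish_congr_left e]
    exact extVanish_rees hh i
  have hzero : ExtVanish Q (Q ⧸ IsLocalRing.maximalIdeal Q) Q 0 := by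
    refine extVanish_zero_iff.2 fun φ => LinearMap.ext fun a => ?_
    obtain ⟨a, rfl⟩ := Ideal.Quotient.mk_surjective a
    refine (mul_left_mem_nonZeroDivisors_eq_zero_iff hh).1 ?_
    rw [← smul_eq_mul, ← map_smul, ← map_zero φ]
    congr 1
    exact Ideal.Quotient.eq_zero_iff_mem.2 (Ideal.mul_mem_right _ _ hm)
  rw [ringDepth_eq, ringDepth_eq]
  refine le_antisymm (le_sInf ?_) ?_
  · rintro _ ⟨i, rfl, hi⟩
    obtain _ | i := i
    · exact absurd hzero hi
    · push_cast
      gcongr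
      exact sInf_le ⟨i, rfl, fun h => hi ((hsucc i).2 h)⟩
  · obtain hS | hS := Set.eq_empty_or_nonempty {n : ℕ∞ | ∃ i : ℕ, n = i ∧ ¬ ExtVanish R k R i}
    · rw [hS]; simp
    · obtain ⟨i, hi, hik⟩ := csInf_mem hS
      rw [hi]
      exact sInf_le ⟨i + 1, by push_cast; rfl, fun h => hik ((hsucc i).1 h)⟩

lemma IsCohenMacaulayLocalRing.quotient [IsNoetherianRing Q] (hCM : IsCohenMacaulayLocalRing Q)
    {h : Q} (hh : h ∈ nonZeroDivisors Q) (hm : h ∈ IsLocalRing.maximalIdeal Q)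
    [IsLocalRing (Q ⧸ Ideal.span {h})] : IsCohenMacaulayLocalRing (Q ⧸ Ideal.span {h}) := by
  have hdim := ringKrullDim_quotient_span_singleton_succ_eq_ringKrullDim_of_mem_jacobson
    (R := Q) (x := h) (isSMulRegular_self_iff.2 hh)
    (by rwa [IsLocalRing.ringJacobson_eq_maximalIdeal])
  rw [IsCohenMacaulayLocalRing, ← ringDepth_quotient_add_one hh hm, ← hdim] at hCM
  rw [IsCohenMacaulayLocalRing]
  have hbot := ringKrullDim_ne_bot (R := Q ⧸ Ideal.span {h})
  generalize ringKrullDim (Q ⧸ Ideal.span {h}) = d at hCM hbot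
  lift d to ℕ∞ using hbot
  exact_mod_cast ENat.add_left_injective_of_ne_top ENat.one_ne_top (WithBot.coe_injective hCM)

end Depth

open RingTheory.Sequence in
/-- The leading term of a regular sequence of length at least two can be modified by the other
terms so that the quotient by it remains generically Gorenstein. -/
lemma exists_add_isGenericallyGorenstein_quotient {Q : Type} [CommRing Q] [IsNoetherianRing Q]
    [IsLocalRing Q] (hgen : IsGenericallyGorenstein Q)
    (himg : ∃ (G : Type) (_ : CommRing G), IsGorensteinLocalRing G ∧
      ∃ f : G →+* Q, Function.Surjective f)
    {a b : Q} {rs : List Q} (hreg : IsWeaklyRegular Q (a :: b :: rs))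
    (hm : ∀ r ∈ a :: b :: rs, r ∈ IsLocalRing.maximalIdeal Q) :
    ∃ y ∈ Ideal.ofList (b :: rs), IsGenericallyGorenstein (Q ⧸ Ideal.span {a + y}) := by
  obtain ⟨x, hx, hgood⟩ := exists_nonZeroDivisor_injDimLE_one hgen himg
  let s : Set (Ideal Q) := {P | P.IsPrime ∧ ∃ c, ∀ t, t ∈ P ↔ x ∣ t * c}
  have hs : s.Finite := by
    refine (associatedPrimes.finite Q (Q ⧸ Ideal.span {x})).subset ?_
    rintro P ⟨hP, c, hc⟩
    rw [AssociatedPrimes.mem_iff, isAssociatedPrime_iff]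
    refine ⟨hP, Ideal.Quotient.mk _ c, Ideal.ext fun t => ?_⟩
    rw [hc, Submodule.mem_colon_singleton, ← Ideal.Quotient.eq_zero_iff_dvd, map_mul]
    rfl
  obtain ⟨y, hy, hyP⟩ := exists_add_notMem_of_finite hs (fun P hP => hP.1) (a := a)
    (J := Ideal.ofList (b :: rs)) fun P ⟨hP, c, hc⟩ haP hle => by
      have ha := (isWeaklyRegular_cons_iff_quotient.1 hreg).1
      obtain ⟨c, hc⟩ := exists_mem_iff_dvd_mul hx ha hc haP
      have hbP : b ∈ P := hle (Ideal.subset_span List.mem_cons_self)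
      refine hP.ne_top ((Ideal.eq_top_iff_one P).2 ((hc 1).2 ?_))
      rw [one_mul]
      exact hreg.dvd_of_dvd_mul ((hc b).1 hbP)
  have hay := (isWeaklyRegular_cons_iff_quotient.1 (hreg.add_of_mem hm hy)).1
  exact ⟨y, hy, isGenericallyGorenstein_quotient hx hay hgood fun P hP c hc => hyP P ⟨hP, c, hc⟩⟩

lemma ofList_add_cons {Q : Type} [CommRing Q] {a y : Q} {rs : List Q} (hy : y ∈ Ideal.ofList rs) :
    Ideal.ofList ((a + y) :: rs) = Ideal.ofList (a :: rs) := by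
  rw [Ideal.ofList_cons, Ideal.ofList_cons]
  refine le_antisymm (sup_le ?_ le_sup_right) (sup_le ?_ le_sup_right) <;>
    rw [Ideal.span_singleton_le_iff_mem]
  · exact Ideal.add_mem _ (Ideal.mem_sup_left (Ideal.mem_span_singleton_self a))
      (Ideal.mem_sup_right hy)
  · rw [← Ideal.add_mem_iff_left _ (Ideal.mem_sup_right hy)]
    exact Ideal.mem_sup_left (Ideal.mem_span_singleton_self _)

/-- Let `Q` be a generically Gorenstein Cohen-Macaulay local ring which is
a homomorphic image of a Gorenstein local ring, let `g` be a `Q`-regular sequence of length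
`s ≥ 1` and `R = Q/(g)`.  Then `R ≅ P/(g')` where `P` is a generically Gorenstein
Cohen-Macaulay local ring which is a homomorphic image of a Gorenstein local ring and `g'`
is a single `P`-regular element. -/
theorem quotient_by_regular_sequence_eq_quotient_by_regular_element
    (Q : Type) [CommRing Q] [IsNoetherianRing Q] [IsLocalRing Q]
    (hgenQ : IsGenericallyGorenstein Q) (hCMQ : IsCohenMacaulayLocalRing Q)
    (himgQ : ∃ (G : Type) (_ : CommRing G), IsGorensteinLocalRing G ∧
      ∃ f : G →+* Q, Function.Surjective f)
    (g : List Q) (hg : RingTheory.Sequence.IsRegular Q g) (hlen : 1 ≤ g.length) :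
    ∃ (P : Type) (iP : CommRing P),
      letI := iP
      ∃ (_ : IsNoetherianRing P) (lP : IsLocalRing P),
        letI := lP
        IsGenericallyGorenstein P ∧ IsCohenMacaulayLocalRing P ∧
        (∃ (G : Type) (_ : CommRing G), IsGorensteinLocalRing G ∧
          ∃ f : G →+* P, Function.Surjective f) ∧
        ∃ g' : P, g' ∈ IsLocalRing.maximalIdeal P ∧ g' ∈ nonZeroDivisors P ∧
          Nonempty ((Q ⧸ Ideal.ofList g) ≃+* (P ⧸ Ideal.span {g'})) := by
  have hm : ∀ r ∈ g, r ∈ IsLocalRing.maximalIdeal Q := fun r hr =>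
    IsLocalRing.le_maximalIdeal (J := Ideal.ofList g)
      (fun h => hg.top_ne_smul (by rw [h]; simp)) (Ideal.subset_span hr)
  replace hg := hg.toIsWeaklyRegular
  obtain ⟨n, hn⟩ : ∃ n, g.length = n + 1 := ⟨_, (Nat.sub_add_cancel hlen).symm⟩
  clear hlen
  induction n generalizing Q with
  | zero =>
    obtain ⟨a, rfl⟩ := List.length_eq_one_iff.1 hn
    exact ⟨Q, _, inferInstance, inferInstance, hgenQ, hCMQ, himgQ, a, hm a List.mem_cons_self,
      (isWeaklyRegular_cons_iff_quotient.1 hg).1,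
      ⟨Ideal.quotEquivOfEq (Ideal.ofList_singleton a)⟩⟩
  | succ n ih =>
    obtain _ | ⟨a, _ | ⟨b, rs⟩⟩ := g
    · simp at hn
    · simp at hn
    obtain ⟨y, hy, hgen⟩ := exists_add_isGenericallyGorenstein_quotient hgenQ himgQ hg hm
    obtain ⟨hh, hreg⟩ := isWeaklyRegular_cons_iff_quotient.1 (hg.add_of_mem hm hy)
    have hofList := ofList_add_cons (a := a) hy
    have hle : Ideal.ofList (a :: b :: rs) ≤ IsLocalRing.maximalIdeal Q := Ideal.span_le.2 hm
    have hhm : a + y ∈ IsLocalRing.maximalIdeal Q :=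
      hle (hofList ▸ Ideal.subset_span List.mem_cons_self)
    generalize a + y = h at *
    let π := Ideal.Quotient.mk (Ideal.span {h})
    have hπ : Function.Surjective π := Ideal.Quotient.mk_surjective
    have : Nontrivial (Q ⧸ Ideal.span {h}) := Ideal.Quotient.nontrivial_iff.2 fun h' =>
      (IsLocalRing.mem_maximalIdeal _).1 hhm (Ideal.span_singleton_eq_top.1 h')
    have : IsLocalRing (Q ⧸ Ideal.span {h}) := IsLocalRing.of_surjective' π hπ
    obtain ⟨P, iP, nP, lP, hgenP, hCMP, himgP, g', hg'm, hg', ⟨e⟩⟩ :=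
      ih (Q ⧸ Ideal.span {h}) hgen (hCMQ.quotient hh hhm)
        (by
          obtain ⟨G, _, hG, f, hf⟩ := himgQ
          exact ⟨G, _, hG, π.comp f, hπ.comp hf⟩)
        ((b :: rs).map π)
        (fun r hr => by
          obtain ⟨r, hr', rfl⟩ := List.mem_map.1 hr
          rw [← Ideal.mem_comap, IsLocalRing.eq_maximalIdeal
            (Ideal.comap_isMaximal_of_surjective π hπ)]
          exact hm r (List.mem_cons_of_mem _ hr'))
        hreg (by simpa using hn)
    refine ⟨P, iP, nP, lP, hgenP, hCMP, himgP, g', hg'm, hg', ⟨?_⟩⟩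
    refine ((Ideal.quotEquivOfEq ?_).trans
      (DoubleQuot.quotQuotEquivQuotSup (Ideal.span {h}) (Ideal.ofList (b :: rs))).symm).trans
      ((Ideal.quotEquivOfEq (Ideal.map_ofList π (b :: rs))).trans e)
    rw [← hofList, Ideal.ofList_cons h]
end
end

section
/- Let P be a commutative noetherian local ring, let M and N be finitely generated P-modules, let g ∈ P be an element that is a nonzerodivisor on P ⊕ M ⊕ N and lies in the maximal ideal of P, and let n be a positive integer. If Ext^n_{P/(g)}(M/gM, N/gN) = 0, then Ext^n_P(M, N) = 0. -/
open CategoryTheory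

noncomputable section

lemma CategoryTheory.ProjectiveResolution.isZero_Ext_succ_iff
    {R : Type*} [Ring R] {C : Type*} [Category* C] [Abelian C] [Linear R C] [EnoughProjectives C]
    {X : C} (Q : ProjectiveResolution X) (Y : C) (n : ℕ) :
    Limits.IsZero (((Ext R C (n + 1)).obj (Opposite.op X)).obj Y) ↔
      ∀ f : Q.complex.X (n + 1) ⟶ Y, Q.complex.d (n + 2) (n + 1) ≫ f = 0 →
        ∃ h : Q.complex.X n ⟶ Y, Q.complex.d (n + 1) n ≫ h = f := by
  rw [(Q.isoExt (n + 1) Y).isZero_iff, ← HomologicalComplex.exactAt_iff_isZero_homology,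
    HomologicalComplex.exactAt_iff' _ n (n + 1) (n + 2) (by simp) (by simp),
    ShortComplex.moduleCat_exact_iff]
  rfl

lemma isZero_Ext_succ_iff_subsingleton
    {R : Type*} [Ring R] {C : Type*} [Category* C] [Abelian C] [Linear R C] [EnoughProjectives C]
    [HasExt C] (X Y : C) (n : ℕ) :
    Limits.IsZero (((Ext R C (n + 1)).obj (Opposite.op X)).obj Y) ↔
      Subsingleton (Abelian.Ext X Y (n + 1)) := by
  let Q := projectiveResolution X
  rw [Q.isZero_Ext_succ_iff]
  constructor
  · intro H
    refine subsingleton_of_forall_eq 0 fun α => ?_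
    obtain ⟨f, hf, rfl⟩ := Q.extMk_surjective α (n + 2) rfl
    exact (Q.extMk_eq_zero_iff f _ rfl hf n rfl).2 (H f hf)
  · intro H f hf
    exact (Q.extMk_eq_zero_iff f _ rfl hf n rfl).1 (Subsingleton.elim _ _)

namespace CategoryTheory.ShortComplex.ShortExact

open Abelian

variable {C : Type*} [Category* C] [Abelian C] [HasExt C] {S : ShortComplex C}
  [Projective S.X₂]

lemma subsingleton_ext_one_iff (hS : S.ShortExact) (Y : C) :
    Subsingleton (Ext S.X₃ Y 1) ↔ ∀ f : S.X₁ ⟶ Y, ∃ h : S.X₂ ⟶ Y, S.f ≫ h = f := by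
  constructor
  · intro H f
    obtain ⟨x, hx⟩ := Ext.contravariant_sequence_exact₁ hS Y (Ext.mk₀ f) (add_zero 1)
      (Subsingleton.elim _ _)
    obtain ⟨h, rfl⟩ := Ext.addEquiv₀.symm.surjective x
    refine ⟨h, Ext.addEquiv₀.symm.injective ?_⟩
    simpa using hx
  · intro H
    refine subsingleton_of_forall_eq 0 fun α => ?_
    obtain ⟨x, rfl⟩ := Ext.contravariant_sequence_exact₃ hS Y α (Ext.eq_zero_of_projective _)
      (add_zero 1)
    obtain ⟨f, rfl⟩ := Ext.addEquiv₀.symm.surjective x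
    obtain ⟨h, rfl⟩ := H f
    simp [← Ext.mk₀_comp_mk₀]

lemma subsingleton_ext_succ_succ_iff (hS : S.ShortExact) (Y : C) (n : ℕ) :
    Subsingleton (Ext S.X₃ Y (n + 2)) ↔ Subsingleton (Ext S.X₁ Y (n + 1)) := by
  constructor
  · intro H
    refine subsingleton_of_forall_eq 0 fun α => ?_
    obtain ⟨x, rfl⟩ := Ext.contravariant_sequence_exact₁ hS Y α (n₁ := n + 2) (by lia)
      (Subsingleton.elim _ _)
    simp [Ext.eq_zero_of_projective x]
  · intro H
    refine subsingleton_of_forall_eq 0 fun α => ?_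
    obtain ⟨x, rfl⟩ := Ext.contravariant_sequence_exact₃ hS Y α (Ext.eq_zero_of_projective _)
      (n₀ := n + 1) (by lia)
    simp [Subsingleton.elim x 0]

end CategoryTheory.ShortComplex.ShortExact

section QuotientMap

variable {P : Type*} [CommRing P] {K M N : Type*} [AddCommGroup K] [Module P K]
  [AddCommGroup M] [Module P M] [AddCommGroup N] [Module P N]

/-- The `P ⧸ I`-linear map `M / IM → N / IN` induced by a `P`-linear map `M → N`. -/
def LinearMap.quotSMulTopMap (I : Ideal P) (f : M →ₗ[P] N) :
    (M ⧸ (I • ⊤ : Submodule P M)) →ₗ[P ⧸ I] (N ⧸ (I • ⊤ : Submodule P N)) :=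
  (Submodule.mapQ _ _ f (Submodule.smul_top_le_comap_smul_top I f)).extendScalarsOfSurjective
    Ideal.Quotient.mk_surjective

lemma Submodule.mem_ideal_span_singleton_smul_top {g : P} {x : M} :
    x ∈ (Ideal.span {g} • ⊤ : Submodule P M) ↔ ∃ y : M, g • y = x := by
  simp [Submodule.ideal_span_singleton_smul, Submodule.mem_smul_pointwise_iff_exists]

lemma Submodule.projective_quotient_smul_top [Module.Projective P M] (I : Ideal P) :
    Module.Projective (P ⧸ I) (M ⧸ (I • ⊤ : Submodule P M)) :=
  .of_equiv ((TensorProduct.quotTensorEquivQuotSMul M I).extendScalarsOfSurjective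
    Ideal.Quotient.mk_surjective)

/-- If `g` is regular on `N`, a linear map `K → N` with values in `g N` is divisible by `g`. -/
lemma LinearMap.exists_smul_eq_of_isSMulRegular {g : P} (hg : IsSMulRegular N g) (f : K →ₗ[P] N)
    (hf : ∀ x, ∃ y, g • y = f x) : ∃ f' : K →ₗ[P] N, g • f' = f := by
  choose φ hφ using hf
  refine ⟨⟨⟨φ, fun x y => hg ?_⟩, fun c x => hg ?_⟩, LinearMap.ext hφ⟩
  · simp only [hφ, smul_add, map_add]
  · simp only [hφ, map_smul, RingHom.id_apply, smul_comm g c]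

end QuotientMap

section Syzygy

universe u

variable {P : Type u} [CommRing P] {F M : Type u} [AddCommGroup F] [Module P F]
  [AddCommGroup M] [Module P M] (π : F →ₗ[P] M) (I : Ideal P)

lemma LinearMap.quotSMulTopMap_comp_ker_subtype :
    π.quotSMulTopMap I ∘ₗ (LinearMap.ker π).subtype.quotSMulTopMap I = 0 := by
  refine LinearMap.ext fun x => ?_
  obtain ⟨x, rfl⟩ := Submodule.Quotient.mk_surjective _ x
  exact congrArg Submodule.Quotient.mk x.2

/-- The reduction modulo `I` of the complex `ker π → F → M`. -/
abbrev LinearMap.quotShortComplexKer : ShortComplex (ModuleCat.{u} (P ⧸ I)) :=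
  ModuleCat.shortComplexOfCompEqZero ((LinearMap.ker π).subtype.quotSMulTopMap I)
    (π.quotSMulTopMap I) (π.quotSMulTopMap_comp_ker_subtype I)

instance [Module.Projective P F] : Projective (π.quotShortComplexKer I).X₂ :=
  have := Submodule.projective_quotient_smul_top (M := F) I
  ModuleCat.projective_of_categoryTheory_projective _

lemma LinearMap.shortExact_quotShortComplexKer {g : P} (hπ : Function.Surjective π)
    (hg : IsSMulRegular M g) : (π.quotShortComplexKer (Ideal.span {g})).ShortExact := by
  apply ModuleCat.shortComplex_shortExact
  · intro x
    obtain ⟨x, rfl⟩ := Submodule.Quotient.mk_surjective _ x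
    constructor
    · intro hx
      obtain ⟨m, hm⟩ := Submodule.mem_ideal_span_singleton_smul_top.1
        ((Submodule.Quotient.mk_eq_zero _).1 hx)
      obtain ⟨y, rfl⟩ := hπ m
      refine ⟨Submodule.Quotient.mk ⟨x - g • y, by simp [hm]⟩, (Submodule.Quotient.eq _).2 ?_⟩
      exact Submodule.mem_ideal_span_singleton_smul_top.2 ⟨-y, by simp⟩
    · rintro ⟨y, hy⟩
      rw [← hy]
      obtain ⟨y, rfl⟩ := Submodule.Quotient.mk_surjective _ y
      exact congrArg Submodule.Quotient.mk y.2
  · refine (injective_iff_map_eq_zero _).2 fun x hx => ?_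
    obtain ⟨x, rfl⟩ := Submodule.Quotient.mk_surjective _ x
    obtain ⟨y, hy⟩ := Submodule.mem_ideal_span_singleton_smul_top.1
      ((Submodule.Quotient.mk_eq_zero _).1 hx)
    refine (Submodule.Quotient.mk_eq_zero _).2
      (Submodule.mem_ideal_span_singleton_smul_top.2 ⟨⟨y, hg ?_⟩, Subtype.ext hy⟩)
    change g • π y = g • 0
    rw [smul_zero, ← map_smul, hy]
    exact x.2
  · intro x
    obtain ⟨x, rfl⟩ := Submodule.Quotient.mk_surjective _ x
    obtain ⟨y, rfl⟩ := hπ x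
    exact ⟨Submodule.Quotient.mk y, rfl⟩

end Syzygy

/-- If every linear map `K / gK → N / gN` extends along `i`, then so does every `K → N`. -/
lemma exists_extension_of_quotient {P : Type*} [CommRing P] [IsNoetherianRing P] [IsLocalRing P]
    {K F N : Type*} [AddCommGroup K] [Module P K] [Module.Finite P K]
    [AddCommGroup F] [Module P F] [Module.Projective P F]
    [AddCommGroup N] [Module P N] [Module.Finite P N]
    {g : P} (hgN : IsSMulRegular N g) (hgmax : g ∈ IsLocalRing.maximalIdeal P) (i : K →ₗ[P] F)
    (H : ∀ f : (K ⧸ (Ideal.span {g} • ⊤ : Submodule P K)) →ₗ[P ⧸ Ideal.span {g}]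
        (N ⧸ (Ideal.span {g} • ⊤ : Submodule P N)),
      ∃ h : (F ⧸ (Ideal.span {g} • ⊤ : Submodule P F)) →ₗ[P ⧸ Ideal.span {g}]
        (N ⧸ (Ideal.span {g} • ⊤ : Submodule P N)), h ∘ₗ i.quotSMulTopMap (Ideal.span {g}) = f)
    (f : K →ₗ[P] N) : ∃ h : F →ₗ[P] N, h ∘ₗ i = f := by
  suffices (⊤ : Submodule P (K →ₗ[P] N)) ≤ LinearMap.range (LinearMap.lcomp P N i) from
    this (Submodule.mem_top (x := f))
  refine Submodule.le_of_le_smul_of_le_jacobson_bot (I := Ideal.span {g})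
    (IsNoetherian.noetherian _) ?_ fun φ _ => ?_
  · rw [IsLocalRing.jacobson_eq_maximalIdeal _ bot_ne_top]
    simpa using hgmax
  obtain ⟨ψ, hψ⟩ := H (φ.quotSMulTopMap _)
  obtain ⟨h, hh⟩ := Module.projective_lifting_property
    (Submodule.mkQ (Ideal.span {g} • ⊤ : Submodule P N))
    (ψ.restrictScalars P ∘ₗ Submodule.mkQ _) (Submodule.mkQ_surjective _)
  obtain ⟨φ', hφ'⟩ := LinearMap.exists_smul_eq_of_isSMulRegular hgN (φ - h ∘ₗ i) fun x =>
    Submodule.mem_ideal_span_singleton_smul_top.1 <| (Submodule.Quotient.eq _).1 <|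
      (LinearMap.congr_fun hψ (Submodule.Quotient.mk x)).symm.trans
        (LinearMap.congr_fun hh (i x)).symm
  rw [← sub_add_cancel φ (h ∘ₗ i), ← hφ', add_comm]
  exact Submodule.add_mem_sup ⟨h, rfl⟩
    (Submodule.mem_ideal_span_singleton_smul_top.2 ⟨φ', rfl⟩)

/-- For `g` regular on `P`, `M`, `N` and in the maximal ideal of `P`, vanishing of
`Ext^(n+1)_{P/(g)}(M/gM, N/gN)` implies vanishing of `Ext^(n+1)_P(M, N)`: shift dimension down to
`n = 0`, where the Nakayama lemma applies. -/
theorem subsingleton_ext_of_subsingleton_ext_quotient {P : Type} [CommRing P] [IsNoetherianRing P]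
    [IsLocalRing P] {N : Type} [AddCommGroup N] [Module P N] [Module.Finite P N]
    {g : P} (hgP : IsSMulRegular P g) (hgN : IsSMulRegular N g)
    (hgmax : g ∈ IsLocalRing.maximalIdeal P) (n : ℕ)
    {M : Type} [AddCommGroup M] [Module P M] [Module.Finite P M] (hgM : IsSMulRegular M g)
    (H : Subsingleton (Abelian.Ext
      (ModuleCat.of (P ⧸ Ideal.span {g}) (M ⧸ (Ideal.span {g} • ⊤ : Submodule P M)))
      (ModuleCat.of (P ⧸ Ideal.span {g}) (N ⧸ (Ideal.span {g} • ⊤ : Submodule P N))) (n + 1))) :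
    Subsingleton (Abelian.Ext (ModuleCat.of P M) (ModuleCat.of P N) (n + 1)) := by
  induction n generalizing M with
  | zero =>
    obtain ⟨k, π, hπ⟩ := Module.Finite.exists_fin' P M
    refine ((LinearMap.shortExact_shortComplexKer hπ).subsingleton_ext_one_iff _).2 fun f => ?_
    have H' := ((π.shortExact_quotShortComplexKer hπ hgM).subsingleton_ext_one_iff _).1 H
    obtain ⟨h, hh⟩ := exists_extension_of_quotient hgN hgmax (LinearMap.ker π).subtype
      (fun f => (H' (ModuleCat.ofHom f)).imp' ModuleCat.Hom.hom
        fun h hh => congrArg ModuleCat.Hom.hom hh) f.hom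
    exact ⟨ModuleCat.ofHom h, ModuleCat.hom_ext hh⟩
  | succ n ih =>
    obtain ⟨k, π, hπ⟩ := Module.Finite.exists_fin' P M
    have hgF : IsSMulRegular (Fin k → P) g := .pi fun _ => hgP
    exact ((LinearMap.shortExact_shortComplexKer hπ).subsingleton_ext_succ_succ_iff _ n).2 <|
      ih (hgF.submodule _ g) <|
        ((π.shortExact_quotShortComplexKer hπ hgM).subsingleton_ext_succ_succ_iff _ n).1 H

/-- Let `P` be a commutative noetherian local ring, `M`, `N` finitely
generated `P`-modules, `g ∈ P` a nonzerodivisor on `P ⊕ M ⊕ N` lying in the maximal ideal,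
and `n > 0`.  If `Ext^n_{P/(g)}(M/gM, N/gN) = 0` then `Ext^n_P(M, N) = 0`. -/
theorem ext_vanishes_of_ext_quotient_vanishes
    (P : Type) [CommRing P] [IsNoetherianRing P] [IsLocalRing P]
    (M N : Type) [AddCommGroup M] [Module P M] [Module.Finite P M]
    [AddCommGroup N] [Module P N] [Module.Finite P N]
    (g : P) (hgP : IsSMulRegular P g) (hgM : IsSMulRegular M g) (hgN : IsSMulRegular N g)
    (hgmax : g ∈ IsLocalRing.maximalIdeal P)
    (n : ℕ) (hn : 0 < n)
    (hvanish : Limits.IsZero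
      (((Ext (P ⧸ Ideal.span {g}) (ModuleCat (P ⧸ Ideal.span {g})) n).obj
          (Opposite.op (ModuleCat.of (P ⧸ Ideal.span {g})
            (M ⧸ (Ideal.span {g} • ⊤ : Submodule P M))))).obj
        (ModuleCat.of (P ⧸ Ideal.span {g}) (N ⧸ (Ideal.span {g} • ⊤ : Submodule P N))))) :
    Limits.IsZero (((Ext P (ModuleCat P) n).obj
      (Opposite.op (ModuleCat.of P M))).obj (ModuleCat.of P N)) := by
  obtain ⟨n, rfl⟩ := Nat.exists_eq_add_one.2 hn
  rw [isZero_Ext_succ_iff_subsingleton] at hvanish ⊢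
  exact subsingleton_ext_of_subsingleton_ext_quotient hgP hgN hgmax n hgM hvanish
end
end

section
/- Let P be a commutative noetherian local ring, let M and N be finitely generated P-modules, let g ∈ P be an element that is a nonzerodivisor on P ⊕ M ⊕ N, and let n be a positive integer. If Ext^i_P(M, N) = 0 for i = n and i = n+1, then Ext^n_{P/(g)}(M/gM, N/gN) = 0. -/
open CategoryTheory

noncomputable section

universe u v

/-- The vanishing of `Ext^(n + 1)` expressed by extending cocycles along the differentials
of a projective resolution. -/
lemma CategoryTheory.ProjectiveResolution.isZero_ext_succ_iff
    {R : Type*} [Ring R] {C : Type*} [Category* C] [Abelian C] [Linear R C]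
    [EnoughProjectives C] {X : C} (F : ProjectiveResolution X) (Y : C) (n : ℕ) :
    Limits.IsZero (((Ext R C (n + 1)).obj (Opposite.op X)).obj Y) ↔
      ∀ f : F.complex.X (n + 1) ⟶ Y, F.complex.d (n + 2) (n + 1) ≫ f = 0 →
        ∃ h : F.complex.X n ⟶ Y, F.complex.d (n + 1) n ≫ h = f := by
  rw [(F.isoExt (R := R) (n + 1) Y).isZero_iff,
    ← HomologicalComplex.exactAt_iff_isZero_homology,
    HomologicalComplex.exactAt_iff' _ n (n + 1) (n + 2) (by simp) (by simp),
    ShortComplex.moduleCat_exact_iff]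
  exact Iff.rfl

namespace Ideal

variable {R : Type*} [CommRing R] (I : Ideal R)
variable {A B C : Type*} [AddCommGroup A] [Module R A] [AddCommGroup B] [Module R B]
  [AddCommGroup C] [Module R C]

/-- The `R ⧸ I`-linear map `A ⧸ I A → B ⧸ I B` induced by an `R`-linear map `A → B`. -/
def quotientSMulTopMap (f : A →ₗ[R] B) :
    (A ⧸ (I • ⊤ : Submodule R A)) →ₗ[R ⧸ I] (B ⧸ (I • ⊤ : Submodule R B)) :=
  (Submodule.mapQ _ _ f (Submodule.smul_top_le_comap_smul_top I f)).extendScalarsOfSurjective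
    Ideal.Quotient.mk_surjective

@[simp]
lemma quotientSMulTopMap_mk (f : A →ₗ[R] B) (a : A) :
    I.quotientSMulTopMap f (Submodule.Quotient.mk a) = Submodule.Quotient.mk (f a) :=
  rfl

lemma quotientSMulTopMap_id :
    I.quotientSMulTopMap (LinearMap.id : A →ₗ[R] A) = LinearMap.id :=
  LinearMap.ext fun x => Submodule.Quotient.induction_on _ x fun _ => rfl

lemma quotientSMulTopMap_comp (f : B →ₗ[R] C) (e : A →ₗ[R] B) :
    I.quotientSMulTopMap (f ∘ₗ e) = I.quotientSMulTopMap f ∘ₗ I.quotientSMulTopMap e :=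
  LinearMap.ext fun x => Submodule.Quotient.induction_on _ x fun _ => rfl

lemma quotientSMulTopMap_add (f e : A →ₗ[R] B) :
    I.quotientSMulTopMap (f + e) = I.quotientSMulTopMap f + I.quotientSMulTopMap e :=
  LinearMap.ext fun x => Submodule.Quotient.induction_on _ x fun _ => rfl

lemma quotientSMulTopMap_surjective {f : A →ₗ[R] B} (hf : Function.Surjective f) :
    Function.Surjective (I.quotientSMulTopMap f) := fun y => by
  obtain ⟨y, rfl⟩ := Submodule.Quotient.mk_surjective _ y
  obtain ⟨x, rfl⟩ := hf y
  exact ⟨Submodule.Quotient.mk x, rfl⟩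

/-- The functor `A ↦ A ⧸ I A` from `R`-modules to `R ⧸ I`-modules. -/
def quotientSMulTopFunctor (I : Ideal R) : ModuleCat.{v} R ⥤ ModuleCat.{v} (R ⧸ I) where
  obj A := ModuleCat.of (R ⧸ I) (A ⧸ (I • ⊤ : Submodule R A))
  map f := ModuleCat.ofHom (I.quotientSMulTopMap f.hom)
  map_id _ := congrArg ModuleCat.ofHom I.quotientSMulTopMap_id
  map_comp f e := congrArg ModuleCat.ofHom (I.quotientSMulTopMap_comp e.hom f.hom)

instance : (I.quotientSMulTopFunctor : ModuleCat.{v} R ⥤ _).Additive where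
  map_add {_ _ f e} := congrArg ModuleCat.ofHom (I.quotientSMulTopMap_add f.hom e.hom)

instance projective_quotient_smul_top [Module.Projective R A] :
    Module.Projective (R ⧸ I) (A ⧸ (I • ⊤ : Submodule R A)) :=
  .of_equiv ((TensorProduct.quotTensorEquivQuotSMul A I).extendScalarsOfSurjective
    Ideal.Quotient.mk_surjective)

lemma mem_span_singleton_smul_top {g : R} {a : A} :
    a ∈ (Ideal.span {g} • ⊤ : Submodule R A) ↔ ∃ b, g • b = a := by
  simp [Submodule.ideal_span_singleton_smul, Submodule.mem_smul_pointwise_iff_exists]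

/-- Reduction modulo `g` preserves exactness at `B` of `A → B → C` as long as `g` is a
nonzerodivisor on the cokernel of `B → C`. -/
lemma exact_quotientSMulTopMap {d : A →ₗ[R] B} {e : B →ₗ[R] C} (h : Function.Exact d e) {g : R}
    (hg : ∀ c, g • c ∈ e.range → c ∈ e.range) :
    Function.Exact ((Ideal.span {g}).quotientSMulTopMap d)
      ((Ideal.span {g}).quotientSMulTopMap e) := by
  intro x
  constructor
  · obtain ⟨x, rfl⟩ := Submodule.Quotient.mk_surjective _ x
    intro hx
    rw [quotientSMulTopMap_mk, Submodule.Quotient.mk_eq_zero, mem_span_singleton_smul_top] at hx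
    obtain ⟨c, hc⟩ := hx
    obtain ⟨z, rfl⟩ := hg c ⟨x, hc.symm⟩
    obtain ⟨w, hw⟩ := (h (x - g • z)).1 (by simp [hc])
    refine ⟨Submodule.Quotient.mk w, ?_⟩
    rw [quotientSMulTopMap_mk, hw, Submodule.Quotient.eq, mem_span_singleton_smul_top]
    exact ⟨-z, by simp⟩
  · rintro ⟨y, rfl⟩
    obtain ⟨y, rfl⟩ := Submodule.Quotient.mk_surjective _ y
    simp [h.apply_apply_eq_zero]

end Ideal

lemma IsSMulRegular.of_projective {R A : Type*} [CommRing R] [AddCommGroup A] [Module R A]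
    [Module.Projective R A] {g : R} (hg : IsSMulRegular R g) : IsSMulRegular A g := by
  obtain ⟨s, hs⟩ := Module.projective_def'.1 ‹Module.Projective R A›
  intro a b hab
  apply Function.LeftInverse.injective (g := Finsupp.linearCombination R id) (f := s)
    (fun x => LinearMap.congr_fun hs x)
  ext i
  apply hg
  simpa using DFunLike.congr_fun (congrArg s hab) i

section Resolution

variable {R : Type u} [CommRing R] {g : R} {X : ModuleCat.{v} R}

lemma CategoryTheory.ProjectiveResolution.function_exact_succ (F : ProjectiveResolution X)
    (n : ℕ) :
    Function.Exact (F.complex.d (n + 2) (n + 1)).hom (F.complex.d (n + 1) n).hom :=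
  (ShortComplex.ShortExact.moduleCat_exact_iff_function_exact _).1 (F.exact_succ n)

lemma CategoryTheory.ProjectiveResolution.function_exact_augmentation
    (F : ProjectiveResolution X) :
    Function.Exact (F.complex.d 1 0).hom (F.π.f 0).hom :=
  (ShortComplex.ShortExact.moduleCat_exact_iff_function_exact _).1
    (ShortComplex.exact_of_g_is_cokernel (.mk _ _ F.complex_d_comp_π_f_zero)
      F.isColimitCokernelCofork)

lemma CategoryTheory.ProjectiveResolution.augmentation_surjective
    (F : ProjectiveResolution X) : Function.Surjective (F.π.f 0).hom :=
  (ModuleCat.epi_iff_surjective _).1 inferInstance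

/-- A nonzerodivisor on `R` and `X` is a nonzerodivisor on every syzygy of `X`. -/
lemma CategoryTheory.ProjectiveResolution.mem_range_d_of_smul_mem [Small.{v} R]
    (F : ProjectiveResolution X) (hgR : IsSMulRegular R g) (hgX : IsSMulRegular X g) (n : ℕ)
    (c : F.complex.X n) (hc : g • c ∈ (F.complex.d (n + 1) n).hom.range) :
    c ∈ (F.complex.d (n + 1) n).hom.range := by
  cases n with
  | zero =>
    have h := F.function_exact_augmentation
    refine (h c).1 (hgX ?_)
    have := (h (g • c)).2 hc
    exact (map_smul (F.π.f 0).hom g c).symm.trans (this.trans (smul_zero g).symm)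
  | succ n =>
    have : Module.Projective R (F.complex.X n) :=
      (IsProjective.iff_projective (F.complex.X n)).2 (F.projective n)
    have h := F.function_exact_succ n
    refine (h c).1 (hgR.of_projective (A := F.complex.X n) ?_)
    simpa using (h (g • c)).2 hc

lemma CategoryTheory.ProjectiveResolution.map_d_comp_map_π_f_zero
    {C D : Type*} [Category* C] [Category* D] [Preadditive C] [Preadditive D]
    [Limits.HasZeroObject C] {X : C} (F : ProjectiveResolution X) (Φ : C ⥤ D) [Φ.Additive] :
    Φ.map (F.complex.d 1 0) ≫ Φ.map (F.π.f 0) = 0 := by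
  rw [← Φ.map_comp, F.complex_d_comp_π_f_zero, Φ.map_zero]

/-- If `g` is a nonzerodivisor on `R` and on `X`, the reduction modulo `g` of a projective
resolution of `X` is a projective resolution of `X ⧸ g X`. -/
def CategoryTheory.ProjectiveResolution.quotientSpanSingleton [Small.{v} R]
    (F : ProjectiveResolution X)
    (hgR : IsSMulRegular R g) (hgX : IsSMulRegular X g) :
    ProjectiveResolution ((Ideal.quotientSMulTopFunctor (Ideal.span {g})).obj X) where
  complex := ((Ideal.quotientSMulTopFunctor (Ideal.span {g})).mapHomologicalComplex _).obj F.complex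
  projective n := by
    have : Module.Projective R (F.complex.X n) :=
      (IsProjective.iff_projective (F.complex.X n)).2 (F.projective n)
    exact (IsProjective.iff_projective _).1 (Ideal.projective_quotient_smul_top (Ideal.span {g}))
  π := (ChainComplex.toSingle₀Equiv _ _).symm
    ⟨(Ideal.quotientSMulTopFunctor (Ideal.span {g})).map (F.π.f 0),
      F.map_d_comp_map_π_f_zero (Ideal.quotientSMulTopFunctor (Ideal.span {g}))⟩
  quasiIso := ⟨fun n => by
    cases n with
    | zero =>
      rw [ChainComplex.quasiIsoAt₀_iff, ShortComplex.quasiIso_iff_of_zeros' _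
        (HomologicalComplex.shape (((Ideal.quotientSMulTopFunctor
          (Ideal.span {g})).mapHomologicalComplex _).obj F.complex) 0 0 (by simp)) rfl rfl]
      have hexact : Function.Exact ((Ideal.span {g}).quotientSMulTopMap (F.complex.d 1 0).hom)
          ((Ideal.span {g}).quotientSMulTopMap (F.π.f 0).hom) :=
        Ideal.exact_quotientSMulTopMap F.function_exact_augmentation
          fun c _ => F.augmentation_surjective c
      have hsurj : Function.Surjective ((Ideal.span {g}).quotientSMulTopMap (F.π.f 0).hom) :=
        Ideal.quotientSMulTopMap_surjective _ F.augmentation_surjective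
      refine (ShortComplex.exact_and_epi_g_iff_of_iso ?_).2
        ⟨ModuleCat.shortComplex_exact
          (ModuleCat.shortComplexOfCompEqZero _ _ hexact.linearMap_comp_eq_zero) hexact,
          (ModuleCat.epi_iff_surjective _).2 hsurj⟩
      refine ShortComplex.isoMk (Iso.refl _) (Iso.refl _) (Iso.refl _) ?_ ?_
      · exact (Category.id_comp _).trans (Category.comp_id _).symm
      · refine (Category.id_comp _).trans (Eq.trans ?_ (Category.comp_id _).symm)
        exact (ChainComplex.toSingle₀Equiv_symm_apply_f_zero
          (C := ((Ideal.quotientSMulTopFunctor (Ideal.span {g})).mapHomologicalComplex _).obj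
            F.complex) _
          (F.map_d_comp_map_π_f_zero (Ideal.quotientSMulTopFunctor (Ideal.span {g})))).symm
    | succ n =>
      rw [quasiIsoAt_iff_exactAt' _ _ (ChainComplex.exactAt_succ_single_obj _ _),
        HomologicalComplex.exactAt_iff' _ (n + 2) (n + 1) n (by simp) (by simp),
        ShortComplex.ShortExact.moduleCat_exact_iff_function_exact]
      exact Ideal.exact_quotientSMulTopMap (F.function_exact_succ n)
        (F.mem_range_d_of_smul_mem hgR hgX n)⟩

end Resolution

/-- If cocycles at `A₁` and `A₂` with values in `N` are coboundaries, then so are cocycles at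
`A₁ ⧸ g A₁` with values in `N ⧸ g N`. -/
lemma exists_comp_quotientSMulTopMap_eq {R : Type*} [CommRing R] {A₀ A₁ A₂ A₃ N : Type*}
    [AddCommGroup A₀] [Module R A₀] [AddCommGroup A₁] [Module R A₁] [AddCommGroup A₂] [Module R A₂]
    [AddCommGroup A₃] [Module R A₃] [AddCommGroup N] [Module R N] [Module.Projective R A₁]
    {g : R} (hgN : IsSMulRegular N g)
    {d₁ : A₁ →ₗ[R] A₀} {d₂ : A₂ →ₗ[R] A₁} {d₃ : A₃ →ₗ[R] A₂} (hd : d₂ ∘ₗ d₃ = 0)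
    (h₁ : ∀ f : A₁ →ₗ[R] N, f ∘ₗ d₂ = 0 → ∃ e : A₀ →ₗ[R] N, e ∘ₗ d₁ = f)
    (h₂ : ∀ f : A₂ →ₗ[R] N, f ∘ₗ d₃ = 0 → ∃ e : A₁ →ₗ[R] N, e ∘ₗ d₂ = f)
    (f : (A₁ ⧸ (Ideal.span {g} • ⊤ : Submodule R A₁)) →ₗ[R ⧸ Ideal.span {g}]
      (N ⧸ (Ideal.span {g} • ⊤ : Submodule R N)))
    (hf : f ∘ₗ (Ideal.span {g}).quotientSMulTopMap d₂ = 0) :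
    ∃ e : (A₀ ⧸ (Ideal.span {g} • ⊤ : Submodule R A₀)) →ₗ[R ⧸ Ideal.span {g}]
        (N ⧸ (Ideal.span {g} • ⊤ : Submodule R N)),
      e ∘ₗ (Ideal.span {g}).quotientSMulTopMap d₁ = f := by
  obtain ⟨F, hF⟩ := Module.projective_lifting_property
    (Ideal.span {g} • ⊤ : Submodule R N).mkQ (f.restrictScalars R ∘ₗ Submodule.mkQ _)
    (Submodule.mkQ_surjective _)
  have hF' (a : A₁) : Submodule.Quotient.mk (F a) = f (Submodule.Quotient.mk a) :=
    LinearMap.congr_fun hF a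
  have hmem (a : A₂) : F (d₂ a) ∈ (LinearMap.lsmul R N g).range := by
    have h : f (Submodule.Quotient.mk (d₂ a)) = 0 :=
      LinearMap.congr_fun hf (Submodule.Quotient.mk a)
    rw [← hF', Submodule.Quotient.mk_eq_zero, Ideal.mem_span_singleton_smul_top] at h
    exact h
  let H : A₂ →ₗ[R] N := (LinearEquiv.ofInjective (LinearMap.lsmul R N g) hgN).symm ∘ₗ
    (F ∘ₗ d₂).codRestrict _ hmem
  have hH (a : A₂) : g • H a = F (d₂ a) :=
    congrArg Subtype.val ((LinearEquiv.ofInjective (LinearMap.lsmul R N g) hgN).apply_symm_apply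
      ⟨F (d₂ a), hmem a⟩)
  obtain ⟨K, hK⟩ := h₂ H (LinearMap.ext fun a => hgN <| by
    have h : d₂ (d₃ a) = 0 := LinearMap.congr_fun hd a
    simp [hH, h])
  obtain ⟨E, hE⟩ := h₁ (F - g • K) (LinearMap.ext fun a => by
    have h : K (d₂ a) = H a := LinearMap.congr_fun hK a
    simp [h, hH])
  refine ⟨(Ideal.span {g}).quotientSMulTopMap E, LinearMap.ext fun x => ?_⟩
  obtain ⟨x, rfl⟩ := Submodule.Quotient.mk_surjective _ x
  have h : E (d₁ x) = F x - g • K x := LinearMap.congr_fun hE x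
  rw [LinearMap.comp_apply, Ideal.quotientSMulTopMap_mk, Ideal.quotientSMulTopMap_mk, h, ← hF',
    Submodule.Quotient.eq, Ideal.mem_span_singleton_smul_top]
  exact ⟨-K x, by simp⟩

/-- Let `P` be a commutative noetherian local ring, `M`, `N` finitely
generated `P`-modules, `g ∈ P` a nonzerodivisor on `P ⊕ M ⊕ N`, and `n > 0`.  If
`Ext^i_P(M, N) = 0` for `i = n, n + 1`, then `Ext^n_{P/(g)}(M/gM, N/gN) = 0`. -/
theorem ext_quotient_vanishes_of_ext_vanishes
    (P : Type) [CommRing P] [IsNoetherianRing P] [IsLocalRing P]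
    (M N : Type) [AddCommGroup M] [Module P M] [Module.Finite P M]
    [AddCommGroup N] [Module P N] [Module.Finite P N]
    (g : P) (hgP : IsSMulRegular P g) (hgM : IsSMulRegular M g) (hgN : IsSMulRegular N g)
    (n : ℕ) (hn : 0 < n)
    (hvanish : ∀ i : ℕ, i = n ∨ i = n + 1 →
      Limits.IsZero (((Ext P (ModuleCat P) i).obj
        (Opposite.op (ModuleCat.of P M))).obj (ModuleCat.of P N))) :
    Limits.IsZero
      (((Ext (P ⧸ Ideal.span {g}) (ModuleCat (P ⧸ Ideal.span {g})) n).obj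
          (Opposite.op (ModuleCat.of (P ⧸ Ideal.span {g})
            (M ⧸ (Ideal.span {g} • ⊤ : Submodule P M))))).obj
        (ModuleCat.of (P ⧸ Ideal.span {g}) (N ⧸ (Ideal.span {g} • ⊤ : Submodule P N)))) := by
  obtain ⟨m, rfl⟩ : ∃ m, n = m + 1 := ⟨n - 1, by omega⟩
  let F := ProjectiveResolution.of (ModuleCat.of P M)
  let G := F.quotientSpanSingleton hgP hgM
  have h₁ := (F.isZero_ext_succ_iff (R := P) (ModuleCat.of P N) m).1 (hvanish _ (.inl rfl))
  have h₂ := (F.isZero_ext_succ_iff (R := P) (ModuleCat.of P N) (m + 1)).1 (hvanish _ (.inr rfl))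
  have : Module.Projective P (F.complex.X (m + 1)) :=
    (IsProjective.iff_projective (F.complex.X (m + 1))).2 (F.projective (m + 1))
  refine (G.isZero_ext_succ_iff _ m).2 fun f hf => ?_
  obtain ⟨e, he⟩ := exists_comp_quotientSMulTopMap_eq hgN
    (d₁ := (F.complex.d (m + 1) m).hom) (d₂ := (F.complex.d (m + 2) (m + 1)).hom)
    (d₃ := (F.complex.d (m + 3) (m + 2)).hom)
    (congrArg ModuleCat.Hom.hom (F.complex.d_comp_d (m + 3) (m + 2) (m + 1)))
    (fun f hf => by
      obtain ⟨e, he⟩ := h₁ (ModuleCat.ofHom f) (ModuleCat.hom_ext hf)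
      exact ⟨e.hom, congrArg ModuleCat.Hom.hom he⟩)
    (fun f hf => by
      obtain ⟨e, he⟩ := h₂ (ModuleCat.ofHom f) (ModuleCat.hom_ext hf)
      exact ⟨e.hom, congrArg ModuleCat.Hom.hom he⟩)
    f.hom (congrArg ModuleCat.Hom.hom hf)
  exact ⟨ModuleCat.ofHom e, ModuleCat.hom_ext he⟩
end
end
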